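/- Let n ≥ 1 and d ≥ 1 be integers and let A = (A₀,…,A_d) be a tuple of real n×n matrices whose (d+1)n² entries are i.i.d. standard normal N(0,1) random variables. Then the expected condition number of the homogeneous polynomial eigenvalue problem satisfies E[μ(A)] = π · Γ((d+1)n²/2)/Γ(((d+1)n²−1)/2) · Γ((n+1)/2)/Γ(n/2), where the expectation is the Lebesgue integral of the [0,∞]-valued function μ against the Gaussian product measure. -/

import Mathlib

open MeasureTheory ProbabilityTheory Real
open scoped ENNReal Matrix Classical

namespace PEVP

/-- Tuples of `d+1` real `n × n` matrices, as bare functions (for the product measure). -/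
abbrev MatTuple (n d : ℕ) := Fin (d + 1) → Fin n → Fin n → ℝ

/-- The Gaussian measure on tuples: all `(d+1)·n²` entries are i.i.d. `N(0,1)`. -/
noncomputable def gaussTuple (n d : ℕ) : Measure (MatTuple n d) :=
  Measure.pi fun _ => Measure.pi fun _ => Measure.pi fun _ => gaussianReal 0 1

/-- The matrix `P(A,α,β) = ∑ αⁱ β^{d-i} Aᵢ`. -/
noncomputable def Pmat (n d : ℕ) (A : MatTuple n d) (α β : ℝ) : Matrix (Fin n) (Fin n) ℝ :=
  ∑ i : Fin (d + 1), (α ^ (i : ℕ) * β ^ (d - (i : ℕ))) • Matrix.of (A i)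

/-- `(α,β)` is a polynomial eigenvalue of `A`. -/
def IsPEV (n d : ℕ) (A : MatTuple n d) (α β : ℝ) : Prop := (Pmat n d A α β).det = 0

/-- `∂P/∂α (A,α,β)`. -/
noncomputable def Pα (n d : ℕ) (A : MatTuple n d) (α β : ℝ) : Matrix (Fin n) (Fin n) ℝ :=
  ∑ i : Fin (d + 1), (((i : ℕ) : ℝ) * α ^ ((i : ℕ) - 1) * β ^ (d - (i : ℕ))) • Matrix.of (A i)

/-- `∂P/∂β (A,α,β)`. -/
noncomputable def Pβ (n d : ℕ) (A : MatTuple n d) (α β : ℝ) : Matrix (Fin n) (Fin n) ℝ :=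
  ∑ i : Fin (d + 1),
    (((d : ℝ) - ((i : ℕ) : ℝ)) * α ^ (i : ℕ) * β ^ (d - (i : ℕ) - 1)) • Matrix.of (A i)

/-- The vector `v = β·(∂P/∂α)·r − α·(∂P/∂β)·r`. -/
noncomputable def vvec (n d : ℕ) (A : MatTuple n d) (α β : ℝ) (r : Fin n → ℝ) : Fin n → ℝ :=
  β • (Pα n d A α β).mulVec r - α • (Pβ n d A α β).mulVec r

/-- `r` spans the (one-dimensional) kernel of `P(A,α,β)`, `ℓ` spans the kernel of its
transpose, and `ℓᵗ v ≠ 0`. -/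
def GoodPair (n d : ℕ) (A : MatTuple n d) (α β : ℝ) (r ℓ : Fin n → ℝ) : Prop :=
  r ≠ 0 ∧ ℓ ≠ 0 ∧
    LinearMap.ker (Matrix.toLin' (Pmat n d A α β)) = Submodule.span ℝ {r} ∧
    LinearMap.ker (Matrix.toLin' (Pmat n d A α β)ᵀ) = Submodule.span ℝ {ℓ} ∧
    ∑ j, ℓ j * vvec n d A α β r j ≠ 0

/-- Euclidean norm of a vector in `ℝⁿ`. -/
noncomputable def vnorm (n : ℕ) (r : Fin n → ℝ) : ℝ := Real.sqrt (∑ j, r j ^ 2)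

/-- The norm `‖A‖ = (∑ᵢ ‖Aᵢ‖_F²)^{1/2}` of a tuple of matrices. -/
noncomputable def tnorm (n d : ℕ) (A : MatTuple n d) : ℝ :=
  Real.sqrt (∑ i, ∑ j, ∑ k, A i j k ^ 2)

/-- The value `(∑ α^{2k} β^{2(d-k)})^{1/2} · (‖r‖‖ℓ‖ / |ℓᵗv|) · ‖A‖`. -/
noncomputable def muVal (n d : ℕ) (A : MatTuple n d) (α β : ℝ) (r ℓ : Fin n → ℝ) : ℝ :=
  Real.sqrt (∑ k ∈ Finset.range (d + 1), α ^ (2 * k) * β ^ (2 * (d - k))) *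
    (vnorm n r * vnorm n ℓ / |∑ j, ℓ j * vvec n d A α β r j|) * tnorm n d A

/-- The local condition number `μ(A,(α,β)) ∈ [0,∞]`. -/
noncomputable def muLoc (n d : ℕ) (A : MatTuple n d) (α β : ℝ) : ℝ≥0∞ :=
  if h : ∃ p : (Fin n → ℝ) × (Fin n → ℝ), GoodPair n d A α β p.1 p.2 then
    ENNReal.ofReal (muVal n d A α β h.choose.1 h.choose.2)
  else ⊤

/-- A set of canonical representatives for `ℝP¹`: one unit vector in each pair `±(α,β)`. -/
def circleReps : Set (ℝ × ℝ) :=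
  {x | x.1 ^ 2 + x.2 ^ 2 = 1 ∧ (0 < x.2 ∨ (x.2 = 0 ∧ x.1 = 1))}

/-- The polynomial eigenvalues of `A`, as (canonical representatives of) points of `ℝP¹`. -/
def pevReps (n d : ℕ) (A : MatTuple n d) : Set (ℝ × ℝ) :=
  {x ∈ circleReps | IsPEV n d A x.1 x.2}

/-- The condition number `μ(A) ∈ [0,∞]`: the sum of the local condition numbers over all
polynomial eigenvalues `[α:β] ∈ ℝP¹`, set to `∞` when there are infinitely many of them. -/
noncomputable def muTotal (n d : ℕ) (A : MatTuple n d) : ℝ≥0∞ :=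
  if (pevReps n d A).Infinite then ⊤
  else ∑' x : pevReps n d A, muLoc n d A x.1.1 x.1.2

/-- The standard Gaussian measure on `ι → ℝ`. -/
noncomputable abbrev gaussPi (ι : Type*) [Fintype ι] : Measure (ι → ℝ) :=
  Measure.pi fun _ : ι => gaussianReal 0 1

/-- The density of `gaussPi ι` as a function of the squared norm. -/
noncomputable def gaussDensity (c : ℕ) (s : ℝ) : ℝ :=
  (√(2 * π))⁻¹ ^ c * Real.exp (-s / 2)

lemma gaussDensity_nonneg (c : ℕ) (s : ℝ) : 0 ≤ gaussDensity c s := by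
  unfold gaussDensity; positivity

lemma gaussDensity_mul (c e : ℕ) (s t : ℝ) :
    gaussDensity c s * gaussDensity e t = gaussDensity (c + e) (s + t) := by
  unfold gaussDensity
  rw [neg_add, add_div, Real.exp_add, pow_add]
  ring

@[fun_prop]
lemma continuous_gaussDensity (c : ℕ) : Continuous (gaussDensity c) := by
  unfold gaussDensity; fun_prop

lemma gaussianPDFReal_eq_gaussDensity (x : ℝ) :
    gaussianPDFReal 0 1 x = gaussDensity 1 (x ^ 2) := by
  simp [gaussianPDFReal_def, gaussDensity]

lemma prod_gaussianPDFReal {ι : Type*} [Fintype ι] (x : ι → ℝ) :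
    ∏ i, gaussianPDFReal 0 1 (x i) = gaussDensity (Fintype.card ι) (∑ i, x i ^ 2) := by
  simp [gaussianPDFReal_def, gaussDensity, Finset.prod_mul_distrib, ← Real.exp_sum,
    Finset.sum_div, neg_div]

lemma gaussPi_eq_withDensity (ι : Type*) [Fintype ι] :
    gaussPi ι = volume.withDensity
      (fun x => ENNReal.ofReal (gaussDensity (Fintype.card ι) (∑ i, x i ^ 2))) := by
  refine Measure.pi_eq fun s hs => ?_
  rw [withDensity_apply _ (MeasurableSet.univ_pi hs), volume_pi, Measure.restrict_pi_pi]
  simp_rw [← prod_gaussianPDFReal]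
  rw [← ofReal_integral_eq_lintegral_ofReal, integral_fintype_prod_eq_prod,
    ENNReal.ofReal_prod_of_nonneg]
  · refine Finset.prod_congr rfl fun i _ => ?_
    rw [gaussianReal_of_var_ne_zero _ one_ne_zero, withDensity_apply _ (hs i),
      ofReal_integral_eq_lintegral_ofReal]
    · rfl
    · exact (integrable_gaussianPDFReal 0 1).restrict
    · exact Filter.Eventually.of_forall fun x => gaussianPDFReal_nonneg _ _ _
  · exact fun i _ => integral_nonneg fun x => gaussianPDFReal_nonneg _ _ _
  · exact Integrable.fintype_prod fun i => (integrable_gaussianPDFReal 0 1).restrict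
  · exact Filter.Eventually.of_forall fun x =>
      Finset.prod_nonneg fun i _ => gaussianPDFReal_nonneg _ _ _

lemma lintegral_gaussPi {ι : Type*} [Fintype ι] {F : (ι → ℝ) → ℝ≥0∞} (hF : Measurable F) :
    ∫⁻ x, F x ∂gaussPi ι =
      ∫⁻ x, ENNReal.ofReal (gaussDensity (Fintype.card ι) (∑ i, x i ^ 2)) * F x := by
  rw [gaussPi_eq_withDensity, lintegral_withDensity_eq_lintegral_mul _ (by fun_prop) hF]
  rfl

lemma lintegral_gaussianReal (F : ℝ → ℝ≥0∞) :
    ∫⁻ x, F x ∂gaussianReal 0 1 = ∫⁻ x, ENNReal.ofReal (gaussDensity 1 (x ^ 2)) * F x := by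
  rw [gaussianReal_of_var_ne_zero _ one_ne_zero,
    lintegral_withDensity_eq_lintegral_mul_non_measurable _ (by fun_prop)]
  · refine lintegral_congr fun x => ?_
    simp only [Pi.mul_apply, gaussianPDF_def, gaussianPDFReal_eq_gaussDensity]
  · exact Filter.Eventually.of_forall fun x => gaussianPDF_lt_top

/-- The mean of the chi distribution. -/
noncomputable def chiMean (c : ℕ) : ℝ :=
  √2 * Real.Gamma (((c : ℝ) + 1) / 2) / Real.Gamma ((c : ℝ) / 2)

lemma integral_Ioi_pow_mul_exp (k : ℕ) :
    ∫ y in Set.Ioi (0 : ℝ), y ^ k * Real.exp (-y ^ 2 / 2) =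
      (1 / 2 : ℝ) ^ (-((k : ℝ) + 1) / 2) * (1 / 2) * Real.Gamma (((k : ℝ) + 1) / 2) := by
  rw [← integral_rpow_mul_exp_neg_mul_rpow (p := 2) (q := k) (b := 1 / 2) (by norm_num)
    (by have := k.cast_nonneg (α := ℝ); linarith) (by norm_num)]
  refine setIntegral_congr_fun measurableSet_Ioi fun y _ => ?_
  simp only [Real.rpow_natCast, Real.rpow_ofNat]
  congr 2; ring

lemma lintegral_norm_gaussPi (ι : Type*) [Fintype ι] [Nonempty ι] :
    ∫⁻ x, ENNReal.ofReal (√(∑ i, x i ^ 2)) ∂gaussPi ι =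
      ENNReal.ofReal (chiMean (Fintype.card ι)) := by
  set c := Fintype.card ι with hc
  have hc0 : 0 < c := Fintype.card_pos
  have key (f : ℝ → ℝ) : ∫ x : ι → ℝ, f (√(∑ i, x i ^ 2)) =
      c • (volume.real (Metric.ball (0 : EuclideanSpace ℝ ι) 1)) •
        ∫ y in Set.Ioi (0 : ℝ), y ^ (c - 1) • f y := by
    have h := integral_fun_norm_addHaar (volume : Measure (EuclideanSpace ℝ ι)) f
    rw [finrank_euclideanSpace, ← hc] at h
    rw [← h, ← (PiLp.volume_preserving_toLp ι).integral_comp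
      (MeasurableEquiv.toLp 2 (ι → ℝ)).measurableEmbedding]
    simp [EuclideanSpace.norm_eq]
  set V := volume.real (Metric.ball (0 : EuclideanSpace ℝ ι) 1)
  have hnn (x : ι → ℝ) : 0 ≤ ∑ i, x i ^ 2 := Finset.sum_nonneg fun i _ => sq_nonneg _
  have hone : ∫ x : ι → ℝ, gaussDensity c (√(∑ i, x i ^ 2) ^ 2) = 1 := by
    have h1 : ∫⁻ x, 1 ∂gaussPi ι = 1 := by simp
    rw [lintegral_gaussPi measurable_const, ← hc] at h1
    simp only [mul_one] at h1
    rw [integral_eq_lintegral_of_nonneg_ae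
      (Filter.Eventually.of_forall fun x => gaussDensity_nonneg _ _)
      (Continuous.aestronglyMeasurable (by fun_prop))]
    simp_rw [Real.sq_sqrt (hnn _)]
    rw [h1]; simp
  have htwo : ∫ x : ι → ℝ, √(∑ i, x i ^ 2) * gaussDensity c (√(∑ i, x i ^ 2) ^ 2) =
      chiMean c := by
    rw [key fun r => gaussDensity c (r ^ 2)] at hone
    rw [key fun r => r * gaussDensity c (r ^ 2), ← mul_one (chiMean c), ← hone]
    have e1 : ∫ y in Set.Ioi (0 : ℝ), y ^ (c - 1) • gaussDensity c (y ^ 2) =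
        (√(2 * π))⁻¹ ^ c * ((1 / 2 : ℝ) ^ (-(c : ℝ) / 2) * (1 / 2) * Real.Gamma ((c : ℝ) / 2)) := by
      have := integral_Ioi_pow_mul_exp (c - 1)
      rw [Nat.cast_pred hc0, sub_add_cancel] at this
      rw [← this, ← integral_const_mul]
      refine integral_congr_ae (Filter.Eventually.of_forall fun y => ?_)
      simp only [gaussDensity, smul_eq_mul]; ring
    have e2 : ∫ y in Set.Ioi (0 : ℝ), y ^ (c - 1) • (y * gaussDensity c (y ^ 2)) =
        (√(2 * π))⁻¹ ^ c *
          ((1 / 2 : ℝ) ^ (-((c : ℝ) + 1) / 2) * (1 / 2) * Real.Gamma (((c : ℝ) + 1) / 2)) := by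
      rw [← integral_Ioi_pow_mul_exp c, ← integral_const_mul]
      refine integral_congr_ae (Filter.Eventually.of_forall fun y => ?_)
      simp only [gaussDensity, smul_eq_mul]
      have : y ^ c = y ^ (c - 1) * y := by rw [← pow_succ, Nat.sub_add_cancel hc0]
      rw [this]; ring
    rw [e1, e2]
    have hG : Real.Gamma ((c : ℝ) / 2) ≠ 0 := (Real.Gamma_pos_of_pos (by positivity)).ne'
    have h2 : (1 / 2 : ℝ) ^ (-((c : ℝ) + 1) / 2) = (1 / 2 : ℝ) ^ (-(c : ℝ) / 2) * √2 := by
      rw [show -((c : ℝ) + 1) / 2 = -(c : ℝ) / 2 + (-(1 / 2)) by ring,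
        Real.rpow_add (by norm_num), Real.rpow_neg (by norm_num), ← Real.sqrt_eq_rpow]
      congr 1
      rw [← Real.sqrt_inv]; norm_num
    rw [h2, chiMean]
    simp only [nsmul_eq_mul, smul_eq_mul]
    field_simp
  have hpos : 0 < chiMean c := by
    unfold chiMean
    have := Real.Gamma_pos_of_pos (s := (c : ℝ) / 2) (by positivity)
    have := Real.Gamma_pos_of_pos (s := ((c : ℝ) + 1) / 2) (by positivity)
    positivity
  have hint : Integrable
      fun x : ι → ℝ => √(∑ i, x i ^ 2) * gaussDensity c (√(∑ i, x i ^ 2) ^ 2) :=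
    .of_integral_ne_zero (by rw [htwo]; exact hpos.ne')
  rw [lintegral_gaussPi (by fun_prop), ← htwo, ofReal_integral_eq_lintegral_ofReal hint
    (Filter.Eventually.of_forall fun x => mul_nonneg (Real.sqrt_nonneg _)
      (gaussDensity_nonneg _ _))]
  refine lintegral_congr fun x => ?_
  rw [Real.sq_sqrt (hnn x), mul_comm, ENNReal.ofReal_mul (Real.sqrt_nonneg _)]

/-- A volume-compensated shear turns the quadratic form `|x|² + ⟨v, x⟩²` into `|x|²`. -/
lemma lintegral_shear {ι : Type*} [Fintype ι] (v : ι → ℝ) {F : ℝ → ℝ≥0∞} (hF : Measurable F) :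
    ∫⁻ x : ι → ℝ, ENNReal.ofReal (√(1 + ∑ i, v i ^ 2)) *
      F (∑ i, x i ^ 2 + (∑ i, v i * x i) ^ 2) = ∫⁻ x : ι → ℝ, F (∑ i, x i ^ 2) := by
  set q := ∑ i, v i ^ 2 with hq
  have hq0 : 0 ≤ q := Finset.sum_nonneg fun i _ => sq_nonneg _
  set s := √(1 + q) with hs
  have hs2 : s ^ 2 = 1 + q := Real.sq_sqrt (by linarith)
  have hs0 : 0 ≤ s := Real.sqrt_nonneg _
  have hs1 : 0 < s := Real.sqrt_pos.2 (by linarith)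
  set k := 1 / (1 + s) with hk
  have hkq : k * q = s - 1 := by
    rw [hk]; field_simp; nlinarith
  have hkq2 : 2 * k + k ^ 2 * q = 1 := by
    have : k * (1 + s) = 1 := by rw [hk]; field_simp
    nlinarith
  let M : Matrix ι ι ℝ :=
    1 + Matrix.replicateCol Unit (k • v) * Matrix.replicateRow Unit v
  have hdet : M.det = s := by
    rw [Matrix.det_one_add_replicateCol_mul_replicateRow]
    simp only [dotProduct, Pi.smul_apply, smul_eq_mul]
    have : ∑ i, v i * (k * v i) = k * q := by
      rw [hq, Finset.mul_sum]; exact Finset.sum_congr rfl fun i _ => by ring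
    rw [this, hkq]; ring
  have hM (x : ι → ℝ) (i : ι) : (Matrix.toLin' M x) i = x i + k * (∑ j, v j * x j) * v i := by
    simp only [M, Matrix.toLin'_apply, Matrix.add_mulVec, Matrix.one_mulVec, Pi.add_apply]
    congr 1
    simp only [Matrix.mulVec, dotProduct, Matrix.mul_apply, Matrix.replicateCol_apply,
      Matrix.replicateRow_apply, Finset.univ_unique, Finset.sum_const, Finset.card_singleton,
      one_smul, Pi.smul_apply, smul_eq_mul, Finset.mul_sum, Finset.sum_mul]
    exact Finset.sum_congr rfl fun j _ => by ring
  have hnorm (x : ι → ℝ) : ∑ i, (Matrix.toLin' M x) i ^ 2 =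
      ∑ i, x i ^ 2 + (∑ i, v i * x i) ^ 2 := by
    set p := ∑ i, v i * x i with hp
    simp_rw [hM, ← hp]
    have : ∀ i, (x i + k * p * v i) ^ 2 =
        x i ^ 2 + (2 * k * p) * (v i * x i) + (k * p) ^ 2 * v i ^ 2 := fun i => by ring
    simp_rw [this, Finset.sum_add_distrib, ← Finset.mul_sum, ← hp, ← hq]
    linear_combination p ^ 2 * hkq2
  have hmap := Real.map_matrix_volume_pi_eq_smul_volume_pi (M := M) (by rw [hdet]; exact hs1.ne')
  have hmeas : Measurable (Matrix.toLin' M) :=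
    (LinearMap.continuous_of_finiteDimensional _).measurable
  have hFm : Measurable fun x : ι → ℝ => F (∑ i, x i ^ 2) := hF.comp (by fun_prop)
  have h1 := lintegral_map (μ := volume) hFm hmeas
  rw [hmap, lintegral_smul_measure, hdet] at h1
  simp_rw [hnorm] at h1
  rw [lintegral_const_mul, ← h1, smul_eq_mul, ← mul_assoc, ← ENNReal.ofReal_mul hs0,
    abs_of_pos (inv_pos.2 hs1), mul_inv_cancel₀ hs1.ne', ENNReal.ofReal_one, one_mul]
  exact hF.comp (by fun_prop)

/-- Orthogonal matrices preserve the standard Gaussian measure. -/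
lemma measurePreserving_gaussPi_mulVec {ι : Type*} [Fintype ι] (M : Matrix ι ι ℝ)
    (hM : Mᵀ * M = 1) :
    MeasurePreserving (fun x => M *ᵥ x) (gaussPi ι) (gaussPi ι) := by
  have hcont : Continuous fun x : ι → ℝ => M *ᵥ x := by fun_prop
  have hdet : |M.det| = 1 := by
    have := congrArg Matrix.det hM
    rw [Matrix.det_mul, Matrix.det_transpose, Matrix.det_one] at this
    rw [← Real.sqrt_mul_self_eq_abs, this, Real.sqrt_one]
  have hdet0 : M.det ≠ 0 := fun h => by simp [h] at hdet
  have hvol : Measure.map (fun x => M *ᵥ x) volume = (volume : Measure (ι → ℝ)) := by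
    have := Real.map_matrix_volume_pi_eq_smul_volume_pi hdet0
    rwa [abs_inv, hdet, inv_one, ENNReal.ofReal_one, one_smul] at this
  have hnorm (x : ι → ℝ) : ∑ i, (M *ᵥ x) i ^ 2 = ∑ i, x i ^ 2 := by
    have : (M *ᵥ x) ⬝ᵥ (M *ᵥ x) = x ⬝ᵥ x := by
      rw [Matrix.dotProduct_mulVec, Matrix.vecMul_mulVec, hM, Matrix.vecMul_one]
    simpa [dotProduct, sq] using this
  refine ⟨hcont.measurable, ?_⟩
  ext s hs
  rw [Measure.map_apply hcont.measurable hs, gaussPi_eq_withDensity,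
    withDensity_apply _ hs, withDensity_apply _ (hcont.measurable hs)]
  conv_rhs => rw [← hvol, setLIntegral_map hs (by fun_prop) hcont.measurable]
  simp_rw [hnorm]

lemma exists_orthogonal_mulVec_single {ι : Type*} [Fintype ι] [DecidableEq ι] (i₀ : ι)
    (u : ι → ℝ) (hu : ∑ i, u i ^ 2 = 1) :
    ∃ M : Matrix ι ι ℝ, Mᵀ * M = 1 ∧ ∀ i, M i i₀ = u i := by
  have hcard : Module.finrank ℝ (EuclideanSpace ℝ ι) = Fintype.card ι := finrank_euclideanSpace
  have hv : Orthonormal ℝ (Set.domRestrict {i₀} fun _ : ι => (WithLp.toLp 2 u : EuclideanSpace ℝ ι)) := by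
    constructor
    · intro i
      simp [EuclideanSpace.norm_eq, hu]
    · intro i j hij
      exact absurd (Subsingleton.elim i j) hij
  obtain ⟨b, hb⟩ := hv.exists_orthonormalBasis_extension_of_card_eq hcard
  refine ⟨Matrix.of fun i j => b j i, ?_, fun i => ?_⟩
  · ext i j
    have := b.orthonormal
    rw [orthonormal_iff_ite] at this
    simp only [Matrix.mul_apply, Matrix.transpose_apply, Matrix.of_apply, Matrix.one_apply]
    rw [← this i j]
    simp [PiLp.inner_apply, mul_comm]
  · simp [hb i₀ rfl]

lemma lintegral_abs_gaussianReal :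
    ∫⁻ x, ENNReal.ofReal |x| ∂gaussianReal 0 1 = ENNReal.ofReal (√(2 / π)) := by
  have h := lintegral_norm_gaussPi Unit
  have h2 := (measurePreserving_funUnique (gaussianReal 0 1) Unit).lintegral_comp
    (f := fun x => ENNReal.ofReal |x|) (by fun_prop)
  rw [← h2]
  simp only [MeasurableEquiv.funUnique_apply]
  simp only [Finset.univ_unique, Finset.sum_singleton, Real.sqrt_sq_eq_abs] at h
  refine h.trans ?_
  congr 1
  unfold chiMean
  norm_num [Real.Gamma_one_half_eq]

lemma lintegral_abs_dot_gaussPi {ι : Type*} [Fintype ι] (r : ι → ℝ) :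
    ∫⁻ u, ENNReal.ofReal |∑ i, r i * u i| ∂gaussPi ι =
      ENNReal.ofReal (√(2 / π) * √(∑ i, r i ^ 2)) := by
  by_cases hr : r = 0
  · simp [hr]
  obtain ⟨i₀, hi₀⟩ : ∃ i, r i ≠ 0 := by
    by_contra! h; exact hr (funext h)
  have hpos : 0 < ∑ i, r i ^ 2 :=
    Finset.sum_pos' (fun i _ => sq_nonneg _) ⟨i₀, Finset.mem_univ _, by positivity⟩
  set q := √(∑ i, r i ^ 2) with hq
  have hq0 : 0 < q := Real.sqrt_pos.2 hpos
  have hq2 : q ^ 2 = ∑ i, r i ^ 2 := Real.sq_sqrt hpos.le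
  obtain ⟨M, hM, hMr⟩ := exists_orthogonal_mulVec_single i₀ (fun i => r i / q)
    (by simp_rw [div_pow, ← Finset.sum_div, ← hq2]; field_simp)
  have hMr' : Mᵀ *ᵥ r = q • Pi.single i₀ 1 := by
    have : r = q • (M *ᵥ Pi.single i₀ 1) := by
      ext i; simp [hMr]; field_simp
    conv_lhs => rw [this]
    rw [Matrix.mulVec_smul, Matrix.mulVec_mulVec, hM, Matrix.one_mulVec]
  rw [← (measurePreserving_gaussPi_mulVec M hM).lintegral_comp (by fun_prop)]
  have (u : ι → ℝ) : ∑ i, r i * (M *ᵥ u) i = q * u i₀ := by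
    have h : r ⬝ᵥ (M *ᵥ u) = (Mᵀ *ᵥ r) ⬝ᵥ u := by
      rw [Matrix.dotProduct_mulVec, Matrix.mulVec_transpose]
    rw [hMr'] at h
    simpa [dotProduct, Pi.single_apply] using h
  simp_rw [this, abs_mul, abs_of_pos hq0, ENNReal.ofReal_mul hq0.le]
  rw [lintegral_const_mul _ (by fun_prop),
    (measurePreserving_eval (fun _ : ι => gaussianReal 0 1) i₀).lintegral_comp
      (f := fun x => ENNReal.ofReal |x|) (by fun_prop), lintegral_abs_gaussianReal,
    ENNReal.ofReal_mul (Real.sqrt_nonneg _), mul_comm]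

lemma tsum_subtype_unique {α : Type*} {p : α → Prop} {Q : α → ℝ≥0∞} {b : α} (hb : p b)
    (h : ∀ c, p c → c = b) : ∑' t : {t // p t}, Q t = Q b := by
  rw [tsum_eq_single ⟨b, hb⟩]
  rintro ⟨c, hc⟩ hne
  exact absurd (Subtype.ext (h c hc)) hne

/-- One-dimensional area formula with multiplicities. -/
lemma lintegral_tsum_fiber {g g' : ℝ → ℝ} {S : Set ℝ} (hS : MeasurableSet S)
    (hg : ∀ t ∈ S, HasStrictDerivAt g (g' t) t) (h0 : ∀ t ∈ S, g' t ≠ 0)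
    {Q : ℝ → ℝ≥0∞} (hQ : Measurable Q) :
    ∫⁻ a, ∑' t : {t // t ∈ S ∧ g t = a}, Q t = ∫⁻ t in S, ENNReal.ofReal |g' t| * Q t := by
  have hloc : ∀ t ∈ S, ∃ U : Set ℝ, IsOpen U ∧ t ∈ U ∧ Set.InjOn g U := by
    intro t ht
    have hs := (hg t ht).hasStrictFDerivAt_equiv (h0 t ht)
    exact ⟨_, (hs.toOpenPartialHomeomorph g).open_source, hs.mem_toOpenPartialHomeomorph_source,
      (hs.toOpenPartialHomeomorph g).injOn⟩
  choose! U hUo htU hUinj using hloc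
  obtain ⟨T, hTS, hTc, hTU⟩ := TopologicalSpace.countable_cover_nhdsWithin (s := S) (f := U)
    fun t ht => mem_nhdsWithin_of_mem_nhds ((hUo t ht).mem_nhds (htU t ht))
  rcases S.eq_empty_or_nonempty with rfl | hne
  · have (a : ℝ) : IsEmpty {t // t ∈ (∅ : Set ℝ) ∧ g t = a} := ⟨fun t => t.2.1⟩
    simp [tsum_empty]
  have hTne : T.Nonempty := by
    obtain ⟨t, ht⟩ := hne
    obtain ⟨i, hi, -⟩ := Set.mem_iUnion₂.1 (hTU ht)
    exact ⟨i, hi⟩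
  obtain ⟨e, he⟩ := hTc.exists_eq_range hTne
  have heS (k : ℕ) : e k ∈ S := hTS (he ▸ Set.mem_range_self k)
  let W : ℕ → Set ℝ := disjointed fun k => U (e k)
  let V : ℕ → Set ℝ := fun k => S ∩ W k
  have hWsub (k : ℕ) : W k ⊆ U (e k) := disjointed_le _ k
  have hWm (k : ℕ) : MeasurableSet (W k) :=
    MeasurableSet.disjointed (fun i => (hUo _ (heS i)).measurableSet) k
  have hVm (k : ℕ) : MeasurableSet (V k) := hS.inter (hWm k)
  have hVd : Pairwise (Function.onFun Disjoint V) := fun i j hij =>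
    (disjoint_disjointed (fun k => U (e k)) hij).mono Set.inter_subset_right
      Set.inter_subset_right
  have hVU : ⋃ k, V k = S := by
    rw [← Set.inter_iUnion, iUnion_disjointed]
    refine Set.inter_eq_left.2 fun t ht => ?_
    obtain ⟨i, hi, hti⟩ := Set.mem_iUnion₂.1 (hTU ht)
    rw [he] at hi
    obtain ⟨k, rfl⟩ := hi
    exact Set.mem_iUnion.2 ⟨k, hti⟩
  have hinj (k : ℕ) : Set.InjOn g (V k) :=
    (hUinj _ (heS k)).mono (Set.inter_subset_right.trans (hWsub k))
  have hder (k : ℕ) : ∀ t ∈ V k, HasDerivWithinAt g (g' t) (V k) t := fun t ht =>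
    (hg t ht.1).hasDerivAt.hasDerivWithinAt
  let G : ℕ → ℝ → ℝ≥0∞ := fun k a => ∑' t : {t // t ∈ V k ∧ g t = a}, Q t
  have hG1 (k : ℕ) (t : ℝ) (ht : t ∈ V k) : G k (g t) = Q t :=
    tsum_subtype_unique (p := fun s => s ∈ V k ∧ g s = g t) ⟨ht, rfl⟩
      fun c hc => hinj k hc.1 ht hc.2
  have hG0 (k : ℕ) (a : ℝ) (ha : a ∉ g '' V k) : G k a = 0 := by
    have : IsEmpty {t // t ∈ V k ∧ g t = a} := ⟨fun t => ha ⟨t.1, t.2.1, t.2.2⟩⟩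
    exact tsum_empty
  have hGm (k : ℕ) : Measurable (G k) := by
    have hemb : MeasurableEmbedding ((V k).domRestrict g) :=
      measurableEmbedding_of_fderivWithin (hVm k)
        (fun t ht => (hder k t ht).hasFDerivWithinAt) (hinj k)
    have : G k = Function.extend ((V k).domRestrict g) (fun t => Q t) (fun _ => 0) := by
      funext a
      by_cases ha : a ∈ g '' V k
      · obtain ⟨t, ht, rfl⟩ := ha
        rw [hG1 k t ht]
        exact (hemb.injective.extend_apply (fun t => Q t) (fun _ => 0) ⟨t, ht⟩).symm
      · rw [hG0 k a ha, Function.extend_apply']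
        rintro ⟨t, rfl⟩
        exact ha ⟨t.1, t.2, rfl⟩
    rw [this]
    exact hemb.measurable_extend (hQ.comp measurable_subtype_coe) measurable_const
  have hsum (a : ℝ) : ∑' t : {t // t ∈ S ∧ g t = a}, Q t = ∑' k, G k a := by
    have h1 (R : Set ℝ) : ∑' t : {t // t ∈ R ∧ g t = a}, Q t =
        ∑' t, R.indicator (fun t => ({t | g t = a} : Set ℝ).indicator Q t) t := by
      have := tsum_subtype (R ∩ {t | g t = a}) Q
      rw [← Set.indicator_indicator] at this
      exact this
    simp only [G, h1]
    rw [ENNReal.tsum_comm]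
    refine tsum_congr fun t => ?_
    rw [← hVU]
    by_cases ht : t ∈ ⋃ k, V k
    · rw [Set.indicator_of_mem ht]
      obtain ⟨k, hk⟩ := Set.mem_iUnion.1 ht
      rw [tsum_eq_single k, Set.indicator_of_mem hk]
      exact fun j hj => Set.indicator_of_notMem (Set.disjoint_left.1 (hVd hj.symm) hk) _
    · rw [Set.indicator_of_notMem ht, eq_comm, ENNReal.tsum_eq_zero]
      exact fun k => Set.indicator_of_notMem (fun hk => ht (Set.mem_iUnion.2 ⟨k, hk⟩)) _
  simp_rw [hsum]
  rw [lintegral_tsum fun k => (hGm k).aemeasurable]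
  conv_rhs => rw [← hVU]
  rw [lintegral_iUnion hVm hVd]
  refine tsum_congr fun k => ?_
  have hind : ∫⁻ a, G k a = ∫⁻ a in g '' V k, G k a := by
    rw [← lintegral_indicator]
    · refine lintegral_congr fun a => ?_
      by_cases ha : a ∈ g '' V k
      · rw [Set.indicator_of_mem ha]
      · rw [Set.indicator_of_notMem ha, hG0 k a ha]
    · exact measurable_image_of_fderivWithin (hVm k)
        (fun t ht => (hder k t ht).hasFDerivWithinAt) (hinj k)
  rw [hind, lintegral_image_eq_lintegral_abs_deriv_mul (hVm k) (hder k) (hinj k)]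
  exact setLIntegral_congr_fun (hVm k) fun t ht => by simp only [hG1 k t ht]

lemma tendsto_floor_mul_div (t : ℝ) :
    Filter.Tendsto (fun m : ℕ => (⌊t * ((m : ℝ) + 1)⌋ : ℝ) / ((m : ℝ) + 1)) Filter.atTop
      (nhds t) := by
  have h := tendsto_one_div_add_atTop_nhds_zero_nat (𝕜 := ℝ)
  refine tendsto_of_tendsto_of_tendsto_of_le_of_le (g := fun m : ℕ => t - 1 / ((m : ℝ) + 1))
    (h := fun _ => t) (by simpa using h.const_sub t) tendsto_const_nhds (fun m => ?_) fun m => ?_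
  · have hm : (0 : ℝ) < (m : ℝ) + 1 := by positivity
    simp only
    rw [le_div_iff₀ hm, sub_mul, div_mul_cancel₀ _ hm.ne']
    exact (Int.sub_one_lt_floor _).le
  · have hm : (0 : ℝ) < (m : ℝ) + 1 := by positivity
    simp only
    rw [div_le_iff₀ hm]
    exact Int.floor_le _

lemma measurableSet_exists_zero {X : Type*} [TopologicalSpace X] [MeasurableSpace X]
    [OpensMeasurableSpace X] {F : X → ℝ → ℝ} (hF : Continuous (Function.uncurry F)) (a b : ℝ) :
    MeasurableSet {x | ∃ t, F x t = 0 ∧ a ≤ t ∧ t < b} := by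
  have hcl (c : ℝ) : IsClosed {x | ∃ t, F x t = 0 ∧ a ≤ t ∧ t ≤ c} := by
    have h1 : IsClosed {p : X × Set.Icc a c | F p.1 p.2 = 0} :=
      isClosed_eq (hF.comp (continuous_fst.prodMk (continuous_subtype_val.comp continuous_snd)))
        continuous_const
    convert isClosedMap_fst_of_compactSpace _ h1 using 1
    ext x
    simp only [Set.mem_ofPred_eq, Set.mem_image, Prod.exists, exists_and_right, exists_eq_right,
      Subtype.exists, Set.mem_Icc]
    constructor
    · rintro ⟨t, h, h'⟩; exact ⟨t, h', h⟩
    · rintro ⟨t, h', h⟩; exact ⟨t, h, h'⟩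
  have : {x | ∃ t, F x t = 0 ∧ a ≤ t ∧ t < b} =
      ⋃ j : ℕ, {x | ∃ t, F x t = 0 ∧ a ≤ t ∧ t ≤ b - 1 / ((j : ℝ) + 1)} := by
    ext x
    simp only [Set.mem_ofPred_eq, Set.mem_iUnion]
    constructor
    · rintro ⟨t, h, hat, htb⟩
      obtain ⟨j, hj⟩ := exists_nat_one_div_lt (sub_pos.2 htb)
      exact ⟨j, t, h, hat, by linarith⟩
    · rintro ⟨j, t, h, hat, htb⟩
      have : (0 : ℝ) < 1 / ((j : ℝ) + 1) := by positivity
      exact ⟨t, h, hat, by linarith⟩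
  rw [this]
  exact MeasurableSet.iUnion fun j => (hcl _).measurableSet

/-- A sum over the (almost surely finite) zero set of a continuous family depends measurably on
the parameter. -/
lemma aemeasurable_tsum_zeros {X : Type*} [TopologicalSpace X] [MeasurableSpace X]
    [OpensMeasurableSpace X] {μ : Measure X} {F : X → ℝ → ℝ}
    (hF : Continuous (Function.uncurry F)) {q : X → ℝ → ℝ≥0∞}
    (hq : ∀ t, Measurable fun x => q x t) (hfin : ∀ᵐ x ∂μ, {t | F x t = 0}.Finite)
    (hcont : ∀ᵐ x ∂μ, ∀ t, F x t = 0 → ContinuousAt (q x) t) :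
    AEMeasurable (fun x => ∑' t : {t // F x t = 0}, q x t) μ := by
  let B : ℕ → ℤ → Set X := fun m k => {x | ∃ t, F x t = 0 ∧ ⌊t * ((m : ℝ) + 1)⌋ = k}
  have hB (m : ℕ) (k : ℤ) : MeasurableSet (B m k) := by
    have hm : (0 : ℝ) < (m : ℝ) + 1 := by positivity
    convert measurableSet_exists_zero hF ((k : ℝ) / ((m : ℝ) + 1)) (((k : ℝ) + 1) / ((m : ℝ) + 1))
      using 5 with x t
    rw [Int.floor_eq_iff, div_le_iff₀ hm, lt_div_iff₀ hm]
  refine aemeasurable_of_tendsto_metrizable_ae Filter.atTop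
    (f := fun (m : ℕ) x => ∑' k : ℤ, (B m k).indicator (fun x => q x (k / ((m : ℝ) + 1))) x)
    (fun m => (Measurable.tsum fun k => (hq _).indicator (hB m k)).aemeasurable) ?_
  filter_upwards [hfin, hcont] with x hx hc
  set Z := hx.toFinset with hZ
  have hmem (t : ℝ) : t ∈ Z ↔ F x t = 0 := by simp [hZ]
  have hlim : ∑' t : {t // F x t = 0}, q x t = ∑ t ∈ Z, q x t := by
    rw [← Finset.tsum_subtype]
    exact (Equiv.subtypeEquivRight fun t => (hmem t).symm).tsum_eq
      (fun t : {t // t ∈ Z} => q x t)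
  rw [hlim]
  have hinj : ∀ᶠ m : ℕ in Filter.atTop, ∀ t ∈ Z, ∀ s ∈ Z,
      ⌊t * ((m : ℝ) + 1)⌋ = ⌊s * ((m : ℝ) + 1)⌋ → t = s := by
    rw [Filter.eventually_all_finset]
    intro t _
    rw [Filter.eventually_all_finset]
    intro s _
    by_cases hts : t = s
    · exact Filter.Eventually.of_forall fun _ _ => hts
    · filter_upwards [((tendsto_floor_mul_div t).sub (tendsto_floor_mul_div s)).eventually_ne
        (sub_ne_zero.2 hts)] with m hm heq
      rw [heq, sub_self] at hm
      exact absurd rfl hm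
  have htend : Filter.Tendsto
      (fun m : ℕ => ∑ t ∈ Z, q x ((⌊t * ((m : ℝ) + 1)⌋ : ℝ) / ((m : ℝ) + 1))) Filter.atTop
      (nhds (∑ t ∈ Z, q x t)) :=
    tendsto_finsetSum _ fun t ht =>
      (hc t ((hmem t).1 ht)).tendsto.comp (tendsto_floor_mul_div t)
  refine htend.congr' ?_
  filter_upwards [hinj] with m hm
  have himg : ∀ k : ℤ, x ∈ B m k ↔ k ∈ Z.image fun t => ⌊t * ((m : ℝ) + 1)⌋ := by
    intro k
    simp [B, hmem]
  rw [tsum_eq_sum (s := Z.image fun t => ⌊t * ((m : ℝ) + 1)⌋)]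
  · rw [Finset.sum_image fun t ht s hs h => hm t ht s hs h]
    refine Finset.sum_congr rfl fun t ht => ?_
    rw [Set.indicator_of_mem ((himg _).2 (Finset.mem_image_of_mem _ ht))]
  · intro k hk
    rw [Set.indicator_of_notMem (fun h => hk ((himg k).1 h))]

/-- A measurable set meeting every line through a given point in a countable set is null. -/
lemma addHaar_eq_zero_of_countable_lines {E : Type*} [NormedAddCommGroup E] [NormedSpace ℝ E]
    [FiniteDimensional ℝ E] [MeasurableSpace E] [BorelSpace E] (μ : Measure E)
    [μ.IsAddHaarMeasure] {Z : Set E} (hZ : MeasurableSet Z) (W : E)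
    (h : ∀ v : E, {u : ℝ | W + u • v ∈ Z}.Countable) : μ Z = 0 := by
  have hm : MeasurableSet {p : E × ℝ | W + p.2 • p.1 ∉ Z} := by
    have hf : Measurable fun p : E × ℝ => W + p.2 • p.1 := by fun_prop
    exact hf hZ.compl
  have h0 : ∀ᵐ v ∂μ, ∀ᵐ u : ℝ, W + u • v ∉ Z :=
    Filter.Eventually.of_forall fun v => (h v).ae_notMem volume
  rw [Measure.ae_ae_comm hm] at h0
  have h1 : ∀ᵐ u : ℝ, u ≠ 0 := Measure.ae_ne volume 0
  obtain ⟨u, hu, hu0⟩ := (h0.and h1).exists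
  have h2 : μ ((fun v => u • v) ⁻¹' ((fun v => W + v) ⁻¹' Z)) = 0 := by
    exact (measure_eq_zero_iff_ae_notMem.2 hu)
  rw [Measure.addHaar_preimage_smul μ hu0, measure_preimage_add] at h2
  simpa [hu0] using h2

lemma gaussPi_absolutelyContinuous (ι : Type*) [Fintype ι] : gaussPi ι ≪ volume := by
  rw [gaussPi_eq_withDensity]
  exact withDensity_absolutelyContinuous _ _

lemma ae_eval_ne_zero {ι : Type*} [Fintype ι] {p : MvPolynomial ι ℝ} {W : ι → ℝ}
    (hW : MvPolynomial.eval W p ≠ 0) : ∀ᵐ x ∂gaussPi ι, MvPolynomial.eval x p ≠ 0 := by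
  refine (gaussPi_absolutelyContinuous ι).ae_le ?_
  have hZ : MeasurableSet {x | MvPolynomial.eval x p = 0} :=
    (isClosed_eq (MvPolynomial.continuous_eval p) continuous_const).measurableSet
  have := addHaar_eq_zero_of_countable_lines volume hZ W fun v => ?_
  · exact (measure_eq_zero_iff_ae_notMem.1 this).mono fun x hx => hx
  let q : Polynomial ℝ :=
    MvPolynomial.eval₂ Polynomial.C (fun i => Polynomial.C (W i) + Polynomial.X * Polynomial.C (v i)) p
  have hq (u : ℝ) : q.eval u = MvPolynomial.eval (W + u • v) p := by
    have := MvPolynomial.eval₂_comp_left (Polynomial.evalRingHom u) Polynomial.C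
      (fun i => Polynomial.C (W i) + Polynomial.X * Polynomial.C (v i)) p
    simp only [Polynomial.coe_evalRingHom] at this
    rw [this, ← MvPolynomial.eval₂_id]
    congr 1
    · ext; simp
    · funext i; simp; ring
  have hq0 : q ≠ 0 := by
    intro h
    have := hq 0
    rw [h] at this
    simp at this
    exact hW this.symm
  refine Set.Countable.mono (fun u hu => ?_) (q.rootSet ℝ).toFinite.countable
  rw [Polynomial.mem_rootSet]
  exact ⟨hq0, by simpa [hq] using hu⟩

lemma ae_dot_ne_zero {ι : Type*} [Fintype ι] {w : ι → ℝ} (hw : w ≠ 0) :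
    ∀ᵐ x ∂gaussPi ι, ∑ i, x i * w i ≠ 0 := by
  have h (x : ι → ℝ) : MvPolynomial.eval x (∑ i, MvPolynomial.X i * MvPolynomial.C (w i)) =
      ∑ i, x i * w i := by simp
  simp_rw [← h]
  refine ae_eval_ne_zero (W := w) ?_
  rw [h]
  obtain ⟨i, hi⟩ := Function.ne_iff.1 hw
  exact (Finset.sum_pos' (fun _ _ => mul_self_nonneg _)
    ⟨i, Finset.mem_univ _, mul_self_pos.2 hi⟩).ne'

/-- Extend a vector indexed by `{q // q ≠ q₀}` by the value `a` at `q₀`. -/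
noncomputable def insertAt {C : Type*} (q₀ : C) (y : {q // q ≠ q₀} → ℝ) (a : ℝ) : C → ℝ :=
  fun q => if h : q = q₀ then a else y ⟨q, h⟩

@[simp] lemma insertAt_self {C : Type*} (q₀ : C) (y : {q // q ≠ q₀} → ℝ) (a : ℝ) :
    insertAt q₀ y a q₀ = a := by simp [insertAt]

@[simp] lemma insertAt_coe {C : Type*} (q₀ : C) (y : {q // q ≠ q₀} → ℝ) (a : ℝ)
    (q : {q // q ≠ q₀}) : insertAt q₀ y a q = y q := by simp [insertAt, q.2]

lemma measurable_insertAt {C : Type*} (q₀ : C) :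
    Measurable fun p : ({q // q ≠ q₀} → ℝ) × ℝ => insertAt q₀ p.1 p.2 := by
  refine measurable_pi_lambda _ fun q => ?_
  by_cases h : q = q₀
  · simpa [insertAt, h] using measurable_snd
  · simp only [insertAt, h, dif_neg, not_false_eq_true]
    fun_prop

lemma measurePreserving_insertAt {C : Type*} [Fintype C] (q₀ : C) :
    MeasurePreserving (fun p : ({q // q ≠ q₀} → ℝ) × ℝ => insertAt q₀ p.1 p.2)
      ((gaussPi {q // q ≠ q₀}).prod (gaussianReal 0 1)) (gaussPi C) := by
  refine ⟨measurable_insertAt q₀, (Measure.pi_eq fun s hs => ?_).symm⟩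
  rw [Measure.map_apply (measurable_insertAt q₀) (MeasurableSet.univ_pi hs)]
  have : (fun p : ({q // q ≠ q₀} → ℝ) × ℝ => insertAt q₀ p.1 p.2) ⁻¹' Set.univ.pi s =
      (Set.univ.pi fun q : {q // q ≠ q₀} => s q) ×ˢ s q₀ := by
    ext ⟨y, a⟩
    simp only [Set.mem_preimage, Set.mem_univ_pi, Set.mem_prod]
    constructor
    · intro h
      exact ⟨fun q => by simpa using h q, by simpa using h q₀⟩
    · rintro ⟨h1, h2⟩ q
      by_cases hq : q = q₀
      · subst hq; simpa using h2
      · simpa using (insertAt_coe q₀ y a ⟨q, hq⟩).symm ▸ h1 ⟨q, hq⟩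
  rw [this, Measure.prod_prod, Measure.pi_pi, mul_comm]
  exact (Fintype.prod_eq_mul_prod_subtype_ne (fun q => gaussianReal 0 1 (s q)) q₀).symm

lemma sum_insertAt {C : Type*} [Fintype C] (q₀ : C) (y : {q // q ≠ q₀} → ℝ) (a : ℝ)
    (G : ℝ → C → ℝ) :
    ∑ q, G (insertAt q₀ y a q) q = G a q₀ + ∑ q : {q // q ≠ q₀}, G (y q) q := by
  rw [Fintype.sum_eq_add_sum_subtype_ne _ q₀]
  simp

lemma lintegral_inv_one_add_sq :
    ∫⁻ t : ℝ, ENNReal.ofReal (1 + t ^ 2)⁻¹ = ENNReal.ofReal π := by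
  rw [← integral_univ_inv_one_add_sq, ofReal_integral_eq_lintegral_ofReal
    integrable_inv_one_add_sq]
  exact Filter.Eventually.of_forall fun t => by positivity

/-- Kac-Rice weight of a zero `t` of the Gaussian function `∑ x q * w q t`. -/
noncomputable def zeroWeight {C : Type*} [Fintype C] (w w' : C → ℝ → ℝ) (h : ℝ → ℝ) (x : C → ℝ)
    (t : ℝ) : ℝ≥0∞ :=
  ENNReal.ofReal (h (∑ q, x q ^ 2)) *
    ENNReal.ofReal ((1 + t ^ 2)⁻¹ * √(∑ q, w q t ^ 2) / |∑ q, x q * w' q t|)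

lemma aemeasurable_tsum_zeroWeight {C : Type*} [Fintype C] {w w' : C → ℝ → ℝ}
    (hw : ∀ q, Continuous (w q)) (hw' : ∀ q, Continuous (w' q)) {h : ℝ → ℝ} (hh : Measurable h)
    (hfin : ∀ᵐ x ∂gaussPi C, {t | ∑ q, x q * w q t = 0}.Finite)
    (hsimple : ∀ᵐ x ∂gaussPi C, ∀ t, ∑ q, x q * w q t = 0 → ∑ q, x q * w' q t ≠ 0) :
    AEMeasurable (fun x => ∑' t : {t // ∑ q, x q * w q t = 0}, zeroWeight w w' h x t)
      (gaussPi C) := by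
  have hF : Continuous (Function.uncurry fun (x : C → ℝ) t => ∑ q, x q * w q t) := by
    simp only [Function.uncurry_def]
    fun_prop
  have hm (t : ℝ) : Measurable fun x => zeroWeight w w' h x t := by
    unfold zeroWeight
    refine Measurable.mul (ENNReal.measurable_ofReal.comp (hh.comp (by fun_prop))) ?_
    refine ENNReal.measurable_ofReal.comp (measurable_const.div ?_)
    exact Continuous.measurable (by fun_prop)
  refine aemeasurable_tsum_zeros hF hm hfin ?_
  filter_upwards [hsimple] with x hx t ht
  have hne : |∑ q, x q * w' q t| ≠ 0 := abs_ne_zero.2 (hx t ht)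
  refine ENNReal.Tendsto.const_mul ?_ (Or.inr ENNReal.ofReal_ne_top)
  refine (ENNReal.continuous_ofReal.continuousAt (x := _)).comp (f := fun t =>
    (1 + t ^ 2)⁻¹ * √(∑ q, w q t ^ 2) / |∑ q, x q * w' q t|) ?_
  have h1 : Continuous fun t : ℝ => (1 + t ^ 2)⁻¹ * √(∑ q, w q t ^ 2) :=
    (Continuous.inv₀ (by fun_prop) fun t => by positivity).mul (by fun_prop)
  have h2 : Continuous fun t => |∑ q, x q * w' q t| := by fun_prop
  exact h1.continuousAt.div h2.continuousAt hne

section Section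

variable {C : Type*} [Fintype C]

/-- The pivot coordinate of a zero at `t`, as a function of the other coordinates. -/
noncomputable def pivot (q₀ : C) (w : C → ℝ → ℝ) (y : {q // q ≠ q₀} → ℝ) (t : ℝ) : ℝ :=
  -(∑ q : {q // q ≠ q₀}, y q * w q t) / w q₀ t

/-- The derivative of `pivot`. -/
noncomputable def pivotDeriv (q₀ : C) (w w' : C → ℝ → ℝ) (y : {q // q ≠ q₀} → ℝ) (t : ℝ) : ℝ :=
  (-(∑ q : {q // q ≠ q₀}, y q * w' q t) * w q₀ t -
    -(∑ q : {q // q ≠ q₀}, y q * w q t) * w' q₀ t) / w q₀ t ^ 2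

lemma hasStrictDerivAt_pivot {q₀ : C} {w w' : C → ℝ → ℝ} {t : ℝ}
    (hd : ∀ q, HasStrictDerivAt (w q) (w' q t) t) (y : {q // q ≠ q₀} → ℝ) (ht : w q₀ t ≠ 0) :
    HasStrictDerivAt (pivot q₀ w y) (pivotDeriv q₀ w w' y t) t := by
  refine HasStrictDerivAt.div (c := fun t => -(∑ q : {q // q ≠ q₀}, y q * w q t)) ?_ (hd q₀) ht
  exact (HasStrictDerivAt.fun_sum fun (q : {q // q ≠ q₀}) _ => (hd q).const_mul (y q)).neg

lemma pivot_eq_iff {q₀ : C} {w : C → ℝ → ℝ} {t : ℝ} (y : {q // q ≠ q₀} → ℝ) (a : ℝ)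
    (ht : w q₀ t ≠ 0) : pivot q₀ w y t = a ↔ ∑ q, insertAt q₀ y a q * w q t = 0 := by
  rw [sum_insertAt q₀ y a fun s q => s * w q t, pivot, div_eq_iff ht]
  constructor <;> intro h <;> linarith

lemma pivotDeriv_eq {q₀ : C} {w : C → ℝ → ℝ} (w' : C → ℝ → ℝ) {t : ℝ} (y : {q // q ≠ q₀} → ℝ)
    (ht : w q₀ t ≠ 0) : w q₀ t * pivotDeriv q₀ w w' y t =
      -∑ q, insertAt q₀ y (pivot q₀ w y t) q * w' q t := by
  rw [sum_insertAt q₀ y _ fun s q => s * w' q t, pivot, pivotDeriv]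
  field_simp
  ring

end Section

section Section

variable {C : Type*} [Fintype C]

/-- The integrand of the Kac-Rice formula after eliminating the pivot coordinate. -/
noncomputable def pivotIntegrand (q₀ : C) (w : C → ℝ → ℝ) (h : ℝ → ℝ)
    (y : {q // q ≠ q₀} → ℝ) (t : ℝ) : ℝ≥0∞ :=
  ENNReal.ofReal (gaussDensity 1 (pivot q₀ w y t ^ 2)) *
    (ENNReal.ofReal (h (pivot q₀ w y t ^ 2 + ∑ q, y q ^ 2)) *
      ENNReal.ofReal ((1 + t ^ 2)⁻¹ * √(∑ q, w q t ^ 2) / |w q₀ t|))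

lemma measurable_pivot {q₀ : C} {w : C → ℝ → ℝ} (hw : ∀ q, Continuous (w q)) :
    Measurable fun p : ({q // q ≠ q₀} → ℝ) × ℝ => pivot q₀ w p.1 p.2 := by
  unfold pivot
  refine Measurable.div ?_ ?_ <;> exact Continuous.measurable (by fun_prop)

lemma measurable_pivotIntegrand {q₀ : C} {w : C → ℝ → ℝ} (hw : ∀ q, Continuous (w q))
    {h : ℝ → ℝ} (hh : Measurable h) :
    Measurable fun p : ({q // q ≠ q₀} → ℝ) × ℝ => pivotIntegrand q₀ w h p.1 p.2 := by
  have h1 := measurable_pivot (q₀ := q₀) hw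
  have h2 : Measurable fun p : ({q // q ≠ q₀} → ℝ) × ℝ => ∑ q, p.1 q ^ 2 :=
    Continuous.measurable (by fun_prop)
  have h3 : Measurable fun p : ({q // q ≠ q₀} → ℝ) × ℝ =>
      (1 + p.2 ^ 2)⁻¹ * √(∑ q, w q p.2 ^ 2) / |w q₀ p.2| := by
    refine Measurable.div (Measurable.mul (Measurable.inv ?_) ?_) ?_ <;>
      exact Continuous.measurable (by fun_prop)
  have h4 : Measurable (gaussDensity 1) := (continuous_gaussDensity 1).measurable
  unfold pivotIntegrand
  exact (ENNReal.measurable_ofReal.comp (h4.comp (h1.pow_const 2))).mul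
    ((ENNReal.measurable_ofReal.comp (hh.comp ((h1.pow_const 2).add h2))).mul
      (ENNReal.measurable_ofReal.comp h3))

lemma lintegral_pivotIntegrand {q₀ : C} {w : C → ℝ → ℝ} (hw : ∀ q, Continuous (w q))
    {h : ℝ → ℝ} (hh : Measurable h) {t : ℝ} (ht : w q₀ t ≠ 0) :
    ∫⁻ y, pivotIntegrand q₀ w h y t ∂gaussPi {q // q ≠ q₀} =
      ENNReal.ofReal (1 + t ^ 2)⁻¹ * (ENNReal.ofReal (√(2 * π))⁻¹ *
        ∫⁻ y, ENNReal.ofReal (h (∑ q, y q ^ 2)) ∂gaussPi {q // q ≠ q₀}) := by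
  obtain ⟨c, hc⟩ : ∃ c, Fintype.card {q // q ≠ q₀} = c := ⟨_, rfl⟩
  let v : {q // q ≠ q₀} → ℝ := fun q => w q t / w q₀ t
  let G : ℝ → ℝ≥0∞ := fun s => ENNReal.ofReal (gaussDensity (c + 1) s) * ENNReal.ofReal (h s)
  have hG : Measurable G := by
    have h4 : Measurable (gaussDensity (c + 1)) := (continuous_gaussDensity (c + 1)).measurable
    exact (ENNReal.measurable_ofReal.comp h4).mul (ENNReal.measurable_ofReal.comp hh)
  have hpiv (y : {q // q ≠ q₀} → ℝ) : pivot q₀ w y t ^ 2 = (∑ q, v q * y q) ^ 2 := by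
    have : ∑ q, v q * y q = (∑ q, y q * w q t) / w q₀ t := by
      rw [Finset.sum_div]
      exact Finset.sum_congr rfl fun q _ => by simp only [v]; ring
    rw [pivot, this, neg_div, neg_sq]
  have hnorm : √(∑ q, w q t ^ 2) / |w q₀ t| = √(1 + ∑ q, v q ^ 2) := by
    rw [← Real.sqrt_sq_eq_abs, ← Real.sqrt_div' _ (sq_nonneg _),
      Fintype.sum_eq_add_sum_subtype_ne _ q₀, add_div, div_self (pow_ne_zero 2 ht),
      Finset.sum_div]
    simp only [v, div_pow]
  have hk : 0 ≤ (1 + t ^ 2)⁻¹ := by positivity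
  have hmeas : Measurable fun y : {q // q ≠ q₀} → ℝ => pivotIntegrand q₀ w h y t := by
    have h1 : Measurable fun y : {q // q ≠ q₀} → ℝ => (y, t) := measurable_prodMk_right
    have h2 := measurable_pivotIntegrand (q₀ := q₀) hw hh
    have h3 := h2.comp h1
    exact h3
  rw [lintegral_gaussPi hmeas, hc]
  have hL (y : {q // q ≠ q₀} → ℝ) :
      ENNReal.ofReal (gaussDensity c (∑ q, y q ^ 2)) * pivotIntegrand q₀ w h y t =
      ENNReal.ofReal (1 + t ^ 2)⁻¹ * (ENNReal.ofReal (√(1 + ∑ q, v q ^ 2)) *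
        G (∑ q, y q ^ 2 + (∑ q, v q * y q) ^ 2)) := by
    simp only [pivotIntegrand, G, hpiv]
    rw [mul_div_assoc, hnorm, ENNReal.ofReal_mul hk, ← gaussDensity_mul c 1,
      ENNReal.ofReal_mul (gaussDensity_nonneg _ _), add_comm ((∑ q, v q * y q) ^ 2)]
    ring
  have hGy : Measurable fun y : {q // q ≠ q₀} → ℝ => G (∑ q, y q ^ 2) :=
    hG.comp (Continuous.measurable (by fun_prop))
  have hhy : Measurable fun y : {q // q ≠ q₀} → ℝ => ENNReal.ofReal (h (∑ q, y q ^ 2)) :=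
    ENNReal.measurable_ofReal.comp (hh.comp (Continuous.measurable (by fun_prop)))
  simp_rw [hL]
  rw [lintegral_const_mul' _ _ ENNReal.ofReal_ne_top, lintegral_shear v hG,
    lintegral_gaussPi hhy, hc]
  congr 1
  rw [← lintegral_const_mul' _ _ ENNReal.ofReal_ne_top]
  refine lintegral_congr fun y => ?_
  have hs : gaussDensity (c + 1) (∑ q, y q ^ 2) =
      (√(2 * π))⁻¹ * gaussDensity c (∑ q, y q ^ 2) := by
    rw [gaussDensity, gaussDensity, pow_succ]; ring
  simp only [G]
  rw [hs, ENNReal.ofReal_mul (by positivity), mul_assoc]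

/-- For almost every choice of the other coordinates, the weighted zero count integrates over the
pivot coordinate to the integral of `pivotIntegrand`. -/
lemma lintegral_tsum_zeroWeight_insertAt {q₀ : C} {w w' : C → ℝ → ℝ}
    (hw : ∀ q, Continuous (w q)) (hw' : ∀ q, Continuous (w' q))
    (hd : ∀ q t, HasStrictDerivAt (w q) (w' q t) t) {h : ℝ → ℝ} (hh : Measurable h)
    (y : {q // q ≠ q₀} → ℝ)
    (hgen : ∀ᵐ a ∂gaussianReal 0 1, ∀ t, ∑ q, insertAt q₀ y a q * w q t = 0 →
      (w q₀ t = 0 → ∀ q, w q t = 0) ∧ ∑ q, insertAt q₀ y a q * w' q t ≠ 0) :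
    ∫⁻ a, ∑' t : {t // ∑ q, insertAt q₀ y a q * w q t = 0},
        zeroWeight w w' h (insertAt q₀ y a) t ∂gaussianReal 0 1 =
      ∫⁻ t in {t | w q₀ t ≠ 0 ∧ pivotDeriv q₀ w w' y t ≠ 0}, pivotIntegrand q₀ w h y t := by
  set S : Set ℝ := {t | w q₀ t ≠ 0 ∧ pivotDeriv q₀ w w' y t ≠ 0} with hSdef
  have hpm : Measurable (pivot q₀ w y) :=
    (measurable_pivot hw).comp (measurable_const.prodMk measurable_id)
  have hpdm : Measurable (pivotDeriv q₀ w w' y) := by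
    unfold pivotDeriv
    refine Measurable.div ?_ ?_ <;> exact Continuous.measurable (by fun_prop)
  have hS : MeasurableSet S := by
    refine MeasurableSet.inter ?_ ?_
    · exact (hw q₀).measurable (measurableSet_singleton 0).compl
    · exact hpdm (measurableSet_singleton 0).compl
  let Q₀ : ℝ → ℝ≥0∞ := fun t => ENNReal.ofReal (h (pivot q₀ w y t ^ 2 + ∑ q, y q ^ 2)) *
    ENNReal.ofReal ((1 + t ^ 2)⁻¹ * √(∑ q, w q t ^ 2) / |w q₀ t * pivotDeriv q₀ w w' y t|)
  let Q : ℝ → ℝ≥0∞ := fun t => ENNReal.ofReal (gaussDensity 1 (pivot q₀ w y t ^ 2)) * Q₀ t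
  have hQ : Measurable Q := by
    have h3 : Measurable fun t : ℝ =>
        (1 + t ^ 2)⁻¹ * √(∑ q, w q t ^ 2) / |w q₀ t * pivotDeriv q₀ w w' y t| := by
      refine Measurable.div (Measurable.mul (Measurable.inv ?_) ?_) (Measurable.abs
        ((hw q₀).measurable.mul hpdm)) <;>
        exact Continuous.measurable (by fun_prop)
    have h4 : Measurable (gaussDensity 1) := (continuous_gaussDensity 1).measurable
    exact (ENNReal.measurable_ofReal.comp (h4.comp (hpm.pow_const 2))).mul
      ((ENNReal.measurable_ofReal.comp (hh.comp ((hpm.pow_const 2).add_const _))).mul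
        (ENNReal.measurable_ofReal.comp h3))
  have hstep : ∀ᵐ a ∂gaussianReal 0 1,
      ∑' t : {t // ∑ q, insertAt q₀ y a q * w q t = 0},
        zeroWeight w w' h (insertAt q₀ y a) t =
      ∑' t : {t // t ∈ S ∧ pivot q₀ w y t = a}, Q₀ t := by
    filter_upwards [hgen] with a ha
    let Z : Set ℝ := {t | ∑ q, insertAt q₀ y a q * w q t = 0}
    let Z' : Set ℝ := {t | t ∈ S ∧ pivot q₀ w y t = a}
    refine (tsum_subtype Z (zeroWeight w w' h (insertAt q₀ y a))).trans
      (Eq.trans (tsum_congr fun t => ?_) (tsum_subtype Z' Q₀).symm)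
    by_cases ht : ∑ q, insertAt q₀ y a q * w q t = 0
    · rw [Set.indicator_of_mem (show t ∈ Z from ht)]
      obtain ⟨h1, h2⟩ := ha t ht
      by_cases hm : w q₀ t = 0
      · rw [Set.indicator_of_notMem (fun hs => hs.1.1 hm), zeroWeight]
        simp [h1 hm]
      · have hp := (pivot_eq_iff y a hm).2 ht
        have hpd := pivotDeriv_eq w' y hm
        rw [hp] at hpd
        have hne : pivotDeriv q₀ w w' y t ≠ 0 := by
          intro h0
          rw [h0, mul_zero, zero_eq_neg] at hpd
          exact h2 hpd
        rw [Set.indicator_of_mem (show t ∈ Z' from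
          ⟨⟨hm, hne⟩, hp⟩)]
        simp only [Q₀, zeroWeight]
        rw [hpd, abs_neg, hp, sum_insertAt q₀ y a fun s _ => s ^ 2]
    · rw [Set.indicator_of_notMem (show t ∉ Z from ht), Set.indicator_of_notMem]
      rintro ⟨⟨hm, -⟩, hp⟩
      exact ht ((pivot_eq_iff y a hm).1 hp)
  rw [lintegral_congr_ae hstep, lintegral_gaussianReal]
  have hmul (a : ℝ) : ENNReal.ofReal (gaussDensity 1 (a ^ 2)) *
      ∑' t : {t // t ∈ S ∧ pivot q₀ w y t = a}, Q₀ t =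
      ∑' t : {t // t ∈ S ∧ pivot q₀ w y t = a}, Q t := by
    rw [← ENNReal.tsum_mul_left]
    refine tsum_congr fun t => ?_
    simp only [Q, t.2.2]
  simp_rw [hmul]
  rw [lintegral_tsum_fiber hS (fun t ht => hasStrictDerivAt_pivot (fun q => hd q t) y ht.1)
    (fun t ht => ht.2) hQ]
  refine setLIntegral_congr_fun hS fun t ht => ?_
  simp only [Q, Q₀, pivotIntegrand]
  have h1 : 0 < |pivotDeriv q₀ w w' y t| := abs_pos.2 ht.2
  have : (1 + t ^ 2)⁻¹ * √(∑ q, w q t ^ 2) / |w q₀ t| = |pivotDeriv q₀ w w' y t| *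
      ((1 + t ^ 2)⁻¹ * √(∑ q, w q t ^ 2) / |w q₀ t * pivotDeriv q₀ w w' y t|) := by
    rw [abs_mul]
    have := abs_pos.2 ht.1
    field_simp
  rw [this, ENNReal.ofReal_mul h1.le]
  ring

/-- Kac-Rice formula for the zeros of a Gaussian combination of functions on the line. -/
lemma lintegral_tsum_zeroWeight (q₀ : C) {w w' : C → ℝ → ℝ}
    (hw : ∀ q, Continuous (w q)) (hw' : ∀ q, Continuous (w' q))
    (hd : ∀ q t, HasStrictDerivAt (w q) (w' q t) t) {h : ℝ → ℝ} (hh : Measurable h)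
    (hm : {t | w q₀ t = 0}.Finite)
    (hwr : ∀ t, w q₀ t ≠ 0 → ∃ q, w' q t * w q₀ t - w q t * w' q₀ t ≠ 0)
    (hfin : ∀ᵐ x ∂gaussPi C, {t | ∑ q, x q * w q t = 0}.Finite)
    (hsimple : ∀ᵐ x ∂gaussPi C, ∀ t, ∑ q, x q * w q t = 0 → ∑ q, x q * w' q t ≠ 0) :
    ∫⁻ x, ∑' t : {t // ∑ q, x q * w q t = 0}, zeroWeight w w' h x t ∂gaussPi C =
      ENNReal.ofReal π * (ENNReal.ofReal (√(2 * π))⁻¹ *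
        ∫⁻ y, ENNReal.ofReal (h (∑ q, y q ^ 2)) ∂gaussPi {q // q ≠ q₀}) := by
  have hgen0 : ∀ᵐ x ∂gaussPi C, ∀ t, ∑ q, x q * w q t = 0 → w q₀ t = 0 → ∀ q, w q t = 0 := by
    have : ∀ᵐ x ∂gaussPi C, ∀ t ∈ {t | w q₀ t = 0}, ∑ q, x q * w q t = 0 → ∀ q, w q t = 0 := by
      rw [ae_ball_iff hm.countable]
      intro t _
      by_cases h0 : (fun q => w q t) = 0
      · exact Filter.Eventually.of_forall fun _ _ => congrFun h0
      · filter_upwards [ae_dot_ne_zero h0] with x hx h1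
        exact absurd h1 hx
    filter_upwards [this] with x hx t h1 h2 using hx t h2 h1
  have hmp := measurePreserving_insertAt q₀
  have hgen : ∀ᵐ y ∂gaussPi {q // q ≠ q₀}, ∀ᵐ a ∂gaussianReal 0 1,
      ∀ t, ∑ q, insertAt q₀ y a q * w q t = 0 →
      (w q₀ t = 0 → ∀ q, w q t = 0) ∧ ∑ q, insertAt q₀ y a q * w' q t ≠ 0 := by
    refine Measure.ae_ae_of_ae_prod (hmp.quasiMeasurePreserving.ae
      (p := fun x => ∀ t, ∑ q, x q * w q t = 0 →
      (w q₀ t = 0 → ∀ q, w q t = 0) ∧ ∑ q, x q * w' q t ≠ 0) ?_)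
    filter_upwards [hgen0, hsimple] with x h0 h1 t ht using ⟨h0 t ht, h1 t ht⟩
  have hL := aemeasurable_tsum_zeroWeight hw hw' hh hfin hsimple
  rw [← hmp.map_eq] at hL
  have hL' : AEMeasurable (fun p : ({q // q ≠ q₀} → ℝ) × ℝ =>
      ∑' t : {t // ∑ q, insertAt q₀ p.1 p.2 q * w q t = 0},
        zeroWeight w w' h (insertAt q₀ p.1 p.2) t)
      ((gaussPi {q // q ≠ q₀}).prod (gaussianReal 0 1)) :=
    hL.comp_aemeasurable hmp.measurable.aemeasurable
  rw [← hmp.map_eq, lintegral_map' hL hmp.measurable.aemeasurable, lintegral_prod _ hL']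
  have hpdm : Measurable fun p : ({q // q ≠ q₀} → ℝ) × ℝ => pivotDeriv q₀ w w' p.1 p.2 := by
    unfold pivotDeriv
    refine Measurable.div ?_ ?_ <;> exact Continuous.measurable (by fun_prop)
  let T : Set (({q // q ≠ q₀} → ℝ) × ℝ) :=
    {p | w q₀ p.2 ≠ 0 ∧ pivotDeriv q₀ w w' p.1 p.2 ≠ 0}
  have hT : MeasurableSet T := by
    refine MeasurableSet.inter ?_ ?_
    · exact ((hw q₀).measurable.comp measurable_snd) (measurableSet_singleton 0).compl
    · exact hpdm (measurableSet_singleton 0).compl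
  let R : ({q // q ≠ q₀} → ℝ) × ℝ → ℝ≥0∞ :=
    T.indicator fun p => pivotIntegrand q₀ w h p.1 p.2
  have hR : Measurable R := (measurable_pivotIntegrand hw hh).indicator hT
  have hinner : ∀ᵐ y ∂gaussPi {q // q ≠ q₀},
      ∫⁻ a, ∑' t : {t // ∑ q, insertAt q₀ y a q * w q t = 0},
        zeroWeight w w' h (insertAt q₀ y a) t ∂gaussianReal 0 1 = ∫⁻ t, R (y, t) := by
    filter_upwards [hgen] with y hy
    rw [lintegral_tsum_zeroWeight_insertAt hw hw' hd hh y hy, ← lintegral_indicator]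
    · rfl
    · exact hT.preimage measurable_prodMk_left
  rw [lintegral_congr_ae hinner, lintegral_lintegral_swap
    (f := fun y t => R (y, t)) hR.aemeasurable]
  have houter : ∀ᵐ t : ℝ, ∫⁻ y, R (y, t) ∂gaussPi {q // q ≠ q₀} =
      ENNReal.ofReal (1 + t ^ 2)⁻¹ * (ENNReal.ofReal (√(2 * π))⁻¹ *
        ∫⁻ y, ENNReal.ofReal (h (∑ q, y q ^ 2)) ∂gaussPi {q // q ≠ q₀}) := by
    filter_upwards [hm.countable.ae_notMem volume] with t ht
    have ht : w q₀ t ≠ 0 := ht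
    rw [← lintegral_pivotIntegrand hw hh ht]
    refine lintegral_congr_ae ?_
    let u : {q // q ≠ q₀} → ℝ := fun q => w' q t * w q₀ t - w q t * w' q₀ t
    have hu : u ≠ 0 := by
      obtain ⟨q, hq⟩ := hwr t ht
      have hqq : q ≠ q₀ := by rintro rfl; exact hq (by ring)
      exact fun h0 => hq (congrFun h0 ⟨q, hqq⟩)
    filter_upwards [ae_dot_ne_zero hu] with y hy
    have hpd : pivotDeriv q₀ w w' y t ≠ 0 := fun h0 => hy ?_
    · exact Set.indicator_of_mem (show (y, t) ∈ T from ⟨ht, hpd⟩) _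
    have h1 := (div_eq_zero_iff.1 h0).resolve_right (pow_ne_zero 2 ht)
    have h2 : ∑ q, y q * u q = (∑ q : {q // q ≠ q₀}, y q * w' q t) * w q₀ t -
        (∑ q : {q // q ≠ q₀}, y q * w q t) * w' q₀ t := by
      rw [Finset.sum_mul, Finset.sum_mul, ← Finset.sum_sub_distrib]
      exact Finset.sum_congr rfl fun q _ => by simp only [u]; ring
    linarith
  rw [lintegral_congr_ae houter, lintegral_mul_const _ (by fun_prop), lintegral_inv_one_add_sq]

end Section

section Generic

variable {n d : ℕ} {R S : Type*} [CommRing R] [CommRing S]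

/-- The matrix polynomial `∑ Xⁱ Aᵢ`. -/
noncomputable def polyMat (A : Fin (d + 1) → Fin n → Fin n → R) :
    Matrix (Fin n) (Fin n) (Polynomial R) :=
  Matrix.of fun j k => ∑ i : Fin (d + 1), Polynomial.C (A i j k) * Polynomial.X ^ (i : ℕ)

/-- The determinant of the matrix polynomial `∑ Xⁱ Aᵢ`. -/
noncomputable def detPoly (A : Fin (d + 1) → Fin n → Fin n → R) : Polynomial R :=
  (polyMat A).det

/-- The discriminant of `detPoly A`, as a polynomial of formal degree `n * d`. -/
noncomputable def detDisc (A : Fin (d + 1) → Fin n → Fin n → R) : R :=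
  (detPoly A).resultant (Polynomial.derivative (detPoly A)) (n * d) (n * d - 1)

lemma polyMat_map (φ : R →+* S) (A : Fin (d + 1) → Fin n → Fin n → R) :
    (Polynomial.mapRingHom φ).mapMatrix (polyMat A) = polyMat fun i j k => φ (A i j k) := by
  ext1 j k
  simp [polyMat, Polynomial.map_sum]

lemma detPoly_map (φ : R →+* S) (A : Fin (d + 1) → Fin n → Fin n → R) :
    (detPoly A).map φ = detPoly fun i j k => φ (A i j k) := by
  rw [detPoly, detPoly, ← polyMat_map, ← RingHom.map_det, Polynomial.coe_mapRingHom]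

lemma detDisc_map (φ : R →+* S) (A : Fin (d + 1) → Fin n → Fin n → R) :
    φ (detDisc A) = detDisc fun i j k => φ (A i j k) := by
  rw [detDisc, ← Polynomial.resultant_map_map, ← Polynomial.derivative_map, detPoly_map]
  rfl

lemma natDegree_detPoly_le (A : Fin (d + 1) → Fin n → Fin n → R) :
    (detPoly A).natDegree ≤ n * d := by
  rw [detPoly, Matrix.det_apply]
  refine Polynomial.natDegree_sum_le_of_forall_le _ _ fun σ _ => ?_
  refine (Polynomial.natDegree_smul_le _ _).trans ((Polynomial.natDegree_prod_le _ _).trans ?_)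
  refine (Finset.sum_le_card_nsmul _ _ d fun j _ => ?_).trans (by simp)
  rw [polyMat, Matrix.of_apply]
  refine Polynomial.natDegree_sum_le_of_forall_le _ _ fun i _ => ?_
  exact (Polynomial.natDegree_C_mul_X_pow_le _ _).trans (Nat.lt_succ_iff.1 i.2)

lemma eval_derivative_ne_zero_of_detDisc [IsDomain R] {A : Fin (d + 1) → Fin n → Fin n → R}
    (hnd : n * d ≠ 0) (h : detDisc A ≠ 0) {t : R} (ht : (detPoly A).eval t = 0) :
    (Polynomial.derivative (detPoly A)).eval t ≠ 0 := by
  intro h'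
  obtain ⟨p, q, -, -, e⟩ := Polynomial.exists_mul_add_mul_eq_C_resultant (detPoly A)
    (Polynomial.derivative (detPoly A)) (natDegree_detPoly_le A)
    ((Polynomial.natDegree_derivative_le _).trans
      (Nat.sub_le_sub_right (natDegree_detPoly_le A) 1)) (Or.inl hnd)
  have := congrArg (Polynomial.eval t) e
  rw [Polynomial.eval_add, Polynomial.eval_mul, Polynomial.eval_mul, ht, h',
    Polynomial.eval_C] at this
  exact h (by rw [detDisc, ← this]; ring)

/-- A tuple whose determinant polynomial is `∏ⱼ (X ^ d - (j + 1))`. -/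
noncomputable def diagTuple (n d : ℕ) : Fin (d + 1) → Fin n → Fin n → ℝ := fun i j k =>
  if j = k then (if i = Fin.last d then 1 else if i = 0 then -((j : ℝ) + 1) else 0) else 0

lemma detPoly_diagTuple (hd : d ≠ 0) : detPoly (diagTuple n d) =
    ∏ j : Fin n, (Polynomial.X ^ d - Polynomial.C ((j : ℝ) + 1)) := by
  have : polyMat (diagTuple n d) =
      Matrix.diagonal fun j : Fin n => Polynomial.X ^ d - Polynomial.C ((j : ℝ) + 1) := by
    ext1 j k
    by_cases hjk : j = k
    · subst hjk
      obtain ⟨e, rfl⟩ := Nat.exists_eq_succ_of_ne_zero hd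
      rw [Matrix.diagonal_apply_eq, polyMat, Matrix.of_apply, Fin.sum_univ_castSucc,
        Fin.sum_univ_succ]
      have h0 : (0 : Fin (e + 1 + 1)) ≠ Fin.last (e + 1) := (Fin.last_pos).ne
      simp [diagTuple, Fin.castSucc_ne_last, h0]
      ring
    · simp [polyMat, diagTuple, hjk]
  rw [detPoly, this, Matrix.det_diagonal]

lemma detDisc_diagTuple_ne_zero (hd : d ≠ 0) : detDisc (diagTuple n d) ≠ 0 := by
  have hmon (j : Fin n) : (Polynomial.X ^ d - Polynomial.C ((j : ℝ) + 1)).Monic :=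
    Polynomial.monic_X_pow_sub_C _ hd
  have hdeg : (detPoly (diagTuple n d)).natDegree = n * d := by
    rw [detPoly_diagTuple hd, Polynomial.natDegree_prod_of_monic _ _ fun j _ => hmon j]
    simp only [Polynomial.natDegree_X_pow_sub_C]
    simp
  have hsep : (detPoly (diagTuple n d)).Separable := by
    rw [detPoly_diagTuple hd]
    refine Polynomial.separable_prod' (fun i _ j _ hij => ?_) fun j _ => ?_
    · have hne : ((j : ℝ) + 1) - ((i : ℝ) + 1) ≠ 0 := by
        rw [add_sub_add_right_eq_sub, sub_ne_zero]
        exact fun h => hij (Fin.ext (by exact_mod_cast h.symm))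
      refine ⟨Polynomial.C (((j : ℝ) + 1) - ((i : ℝ) + 1))⁻¹,
        -Polynomial.C (((j : ℝ) + 1) - ((i : ℝ) + 1))⁻¹, ?_⟩
      calc _ = Polynomial.C (((j : ℝ) + 1) - ((i : ℝ) + 1))⁻¹ *
          (Polynomial.C ((j : ℝ) + 1) - Polynomial.C ((i : ℝ) + 1)) := by ring
        _ = 1 := by rw [← Polynomial.C_sub, ← Polynomial.C_mul, inv_mul_cancel₀ hne,
          Polynomial.C_1]
    · exact Polynomial.separable_X_pow_sub_C _ (by exact_mod_cast hd) (by positivity)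
  have h := Polynomial.resultant_ne_zero _ _ hsep
  rwa [Polynomial.natDegree_derivative, hdeg] at h

end Generic

/-- The matrix tuple with the entries listed in `x`. -/
abbrev toTuple {n d : ℕ} {R : Type*} (x : Fin (d + 1) × Fin n × Fin n → R) :
    Fin (d + 1) → Fin n → Fin n → R := fun i j k => x (i, j, k)

lemma ae_detDisc_ne_zero {n d : ℕ} (hd : d ≠ 0) :
    ∀ᵐ x ∂gaussPi (Fin (d + 1) × Fin n × Fin n), detDisc (toTuple x) ≠ 0 := by
  have h (x : Fin (d + 1) × Fin n × Fin n → ℝ) :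
      MvPolynomial.eval x (detDisc (toTuple MvPolynomial.X)) = detDisc (toTuple x) := by
    rw [detDisc_map]
    simp
  simp_rw [← h]
  refine ae_eval_ne_zero (W := fun q => diagTuple n d q.1 q.2.1 q.2.2) ?_
  rw [h]
  exact detDisc_diagTuple_ne_zero hd

lemma ae_adjugate_ne_zero {n d : ℕ} (i : Fin (d + 1)) (j : Fin n) :
    ∀ᵐ x ∂gaussPi (Fin (d + 1) × Fin n × Fin n),
      (Matrix.of (toTuple x i)).adjugate j j ≠ 0 := by
  have h (x : Fin (d + 1) × Fin n × Fin n → ℝ) :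
      MvPolynomial.eval x ((Matrix.of (toTuple MvPolynomial.X i)).adjugate j j) =
      (Matrix.of (toTuple x i)).adjugate j j := by
    have := congrFun₂ (RingHom.map_adjugate (MvPolynomial.eval x)
      (Matrix.of (toTuple MvPolynomial.X i))) j j
    rw [RingHom.mapMatrix_apply, Matrix.map_apply] at this
    rw [this]
    refine congrArg (fun M : Matrix (Fin n) (Fin n) ℝ => M.adjugate j j) ?_
    ext1 j k
    simp
  simp_rw [← h]
  refine ae_eval_ne_zero (W := fun q => (1 : Matrix (Fin n) (Fin n) ℝ) q.2.1 q.2.2) ?_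
  rw [h]
  have : Matrix.of (toTuple (fun q : Fin (d + 1) × Fin n × Fin n =>
    (1 : Matrix (Fin n) (Fin n) ℝ) q.2.1 q.2.2) i) = 1 := rfl
  rw [this]
  simp

lemma ae_det_ne_zero {n d : ℕ} (i : Fin (d + 1)) :
    ∀ᵐ x ∂gaussPi (Fin (d + 1) × Fin n × Fin n), (Matrix.of (toTuple x i)).det ≠ 0 := by
  have h (x : Fin (d + 1) × Fin n × Fin n → ℝ) :
      MvPolynomial.eval x (Matrix.of (toTuple MvPolynomial.X i)).det =
      (Matrix.of (toTuple x i)).det := by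
    rw [RingHom.map_det]
    congr 1
    ext1 j k
    simp
  simp_rw [← h]
  refine ae_eval_ne_zero (W := fun q => (1 : Matrix (Fin n) (Fin n) ℝ) q.2.1 q.2.2) ?_
  rw [h]
  have : Matrix.of (toTuple (fun q : Fin (d + 1) × Fin n × Fin n =>
    (1 : Matrix (Fin n) (Fin n) ℝ) q.2.1 q.2.2) i) = 1 := rfl
  rw [this]
  simp

section Adjugate

variable {n : ℕ} {M : Matrix (Fin n) (Fin n) ℝ}

lemma adjugate_col_mem_ker (hM : M.det = 0) (j : Fin n) :
    (fun i => M.adjugate i j) ∈ LinearMap.ker (Matrix.toLin' M) := by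
  rw [LinearMap.mem_ker, Matrix.toLin'_apply]
  have := M.mul_adjugate
  rw [hM, zero_smul] at this
  funext i
  exact congrFun₂ this i j

lemma ker_eq_span_adjugate_col (hM : M.det = 0) {i₀ j₀ : Fin n} (h : M.adjugate i₀ j₀ ≠ 0) :
    LinearMap.ker (Matrix.toLin' M) = Submodule.span ℝ {fun i => M.adjugate i j₀} := by
  refine le_antisymm (fun x hx => ?_) ?_
  · rw [Submodule.mem_span_singleton]
    set r : Fin n → ℝ := fun i => M.adjugate i j₀ with hr
    refine ⟨x i₀ / r i₀, ?_⟩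
    have hker : x - (x i₀ / r i₀) • r ∈ LinearMap.ker (Matrix.toLin' M) :=
      Submodule.sub_mem _ hx (Submodule.smul_mem _ _ (adjugate_col_mem_ker hM j₀))
    set y := x - (x i₀ / r i₀) • r with hy
    have hy0 : y i₀ = 0 := by
      have : r i₀ ≠ 0 := h
      simp [hy, div_mul_cancel₀ _ this]
    rw [LinearMap.mem_ker, Matrix.toLin'_apply] at hker
    rw [Matrix.adjugate_apply] at h
    have hNy : M.updateRow j₀ (Pi.single i₀ 1) *ᵥ y = 0 := by
      funext j
      rw [Matrix.mulVec]
      by_cases hj : j = j₀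
      · subst hj
        simp [hy0]
      · rw [Matrix.updateRow_ne hj]
        exact congrFun hker j
    have : y = 0 := Matrix.eq_zero_of_mulVec_eq_zero h hNy
    exact (sub_eq_zero.1 this).symm
  · rw [Submodule.span_singleton_le_iff_mem]
    exact adjugate_col_mem_ker hM j₀

lemma ker_transpose_eq_span_adjugate_row (hM : M.det = 0) {i₀ j₀ : Fin n}
    (h : M.adjugate i₀ j₀ ≠ 0) :
    LinearMap.ker (Matrix.toLin' Mᵀ) = Submodule.span ℝ {fun j => M.adjugate i₀ j} := by
  have h' : Mᵀ.adjugate j₀ i₀ ≠ 0 := by rwa [← Matrix.adjugate_transpose, Matrix.transpose_apply]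
  have := ker_eq_span_adjugate_col (by rwa [Matrix.det_transpose]) h'
  rwa [← Matrix.adjugate_transpose] at this

lemma exists_adjugate_eq_mul (hM : M.det = 0) {r l : Fin n → ℝ} (hr0 : r ≠ 0)
    (hr : LinearMap.ker (Matrix.toLin' M) = Submodule.span ℝ {r})
    (hl : LinearMap.ker (Matrix.toLin' Mᵀ) = Submodule.span ℝ {l}) :
    ∃ κ : ℝ, ∀ i j, M.adjugate i j = κ * (r i * l j) := by
  have hc (j : Fin n) : ∃ c : ℝ, c • r = fun i => M.adjugate i j := by
    rw [← Submodule.mem_span_singleton, ← hr]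
    exact adjugate_col_mem_ker hM j
  choose c hc using hc
  obtain ⟨i₀, hi₀⟩ := Function.ne_iff.1 hr0
  have hrow : (fun j => M.adjugate i₀ j) ∈ LinearMap.ker (Matrix.toLin' Mᵀ) := by
    have := adjugate_col_mem_ker (M := Mᵀ) (by rwa [Matrix.det_transpose]) i₀
    rwa [← Matrix.adjugate_transpose] at this
  rw [hl, Submodule.mem_span_singleton] at hrow
  obtain ⟨m, hm⟩ := hrow
  refine ⟨m / r i₀, fun i j => ?_⟩
  have h1 := congrFun (hc j) i
  have h2 := congrFun (hc j) i₀
  have h3 := congrFun hm j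
  simp only [Pi.smul_apply, smul_eq_mul] at h1 h2 h3
  have hi₀ : r i₀ ≠ 0 := hi₀
  rw [← h1]
  have : c j = m * l j / r i₀ := by rw [eq_div_iff hi₀, h2, h3]
  rw [this]
  ring

end Adjugate

section Eval

variable {n d : ℕ}

/-- The matrix `∑ tⁱ Aᵢ`. -/
noncomputable def evalMat (A : MatTuple n d) (t : ℝ) : Matrix (Fin n) (Fin n) ℝ :=
  Matrix.of fun j k => ∑ i : Fin (d + 1), A i j k * t ^ (i : ℕ)

/-- The derivative of `evalMat A`. -/
noncomputable def evalMatDeriv (A : MatTuple n d) (t : ℝ) : Matrix (Fin n) (Fin n) ℝ :=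
  Matrix.of fun j k => ∑ i : Fin (d + 1), A i j k * ((i : ℕ) * t ^ ((i : ℕ) - 1))

/-- The derivative of `t ↦ det (∑ tⁱ Aᵢ)`. -/
noncomputable def detDeriv (A : MatTuple n d) (t : ℝ) : ℝ :=
  (Polynomial.derivative (detPoly A)).eval t

lemma polyMat_eval (A : MatTuple n d) (t : ℝ) :
    (Polynomial.evalRingHom t).mapMatrix (polyMat A) = evalMat A t := by
  ext1 j k
  simp [polyMat, evalMat, Polynomial.eval_finsetSum]

lemma detPoly_eval (A : MatTuple n d) (t : ℝ) : (detPoly A).eval t = (evalMat A t).det := by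
  rw [detPoly, ← polyMat_eval, ← RingHom.map_det, Polynomial.coe_evalRingHom]

lemma adjugate_polyMat_eval (A : MatTuple n d) (t : ℝ) :
    (Polynomial.evalRingHom t).mapMatrix (polyMat A).adjugate = (evalMat A t).adjugate := by
  rw [← polyMat_eval, RingHom.map_adjugate]

lemma polyMat_derivative_eval (A : MatTuple n d) (t : ℝ) :
    (Polynomial.evalRingHom t).mapMatrix ((polyMat A).map Polynomial.derivative) =
      evalMatDeriv A t := by
  ext1 j k
  simp [polyMat, evalMatDeriv, Polynomial.eval_finsetSum, Polynomial.derivative_X_pow]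

lemma map_derivative_mul {R : Type*} [CommRing R] (M N : Matrix (Fin n) (Fin n) (Polynomial R)) :
    (M * N).map Polynomial.derivative =
      M.map Polynomial.derivative * N + M * N.map Polynomial.derivative := by
  ext1 j k
  simp [Matrix.mul_apply, Polynomial.derivative_mul,
    Finset.sum_add_distrib]

/-- Jacobi's formula in matrix form. -/
lemma exists_mul_evalMat_add (A : MatTuple n d) (t : ℝ) :
    ∃ B : Matrix (Fin n) (Fin n) ℝ, B * evalMat A t +
      (evalMat A t).adjugate * evalMatDeriv A t = detDeriv A t • 1 := by
  have h := congrArg (fun N : Matrix (Fin n) (Fin n) (Polynomial ℝ) =>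
    N.map Polynomial.derivative) (polyMat A).adjugate_mul
  simp only [map_derivative_mul] at h
  have h2 := congrArg (Polynomial.evalRingHom t).mapMatrix h
  rw [map_add, map_mul, map_mul, polyMat_eval, adjugate_polyMat_eval,
    polyMat_derivative_eval] at h2
  refine ⟨_, h2.trans ?_⟩
  ext1 j k
  by_cases hjk : j = k
  · subst hjk
    simp [detDeriv, detPoly]
  · simp [hjk]

lemma adjugate_ne_zero_of_detDeriv {A : MatTuple n d} {t : ℝ}
    (h0 : (evalMat A t).det = 0) (h1 : detDeriv A t ≠ 0) : (evalMat A t).adjugate ≠ 0 := by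
  intro h
  obtain ⟨B, hB⟩ := exists_mul_evalMat_add A t
  rw [h, zero_mul, add_zero] at hB
  have := congrArg Matrix.det hB
  rw [Matrix.det_mul, h0, mul_zero, Matrix.det_smul, Matrix.det_one, mul_one,
    Fintype.card_fin] at this
  exact pow_ne_zero n h1 this.symm

lemma detDeriv_eq_mul {A : MatTuple n d} {t κ : ℝ} {r l : Fin n → ℝ}
    (h0 : (evalMat A t).det = 0) (hadj : (evalMat A t).adjugate ≠ 0)
    (hκ : ∀ i j, (evalMat A t).adjugate i j = κ * (r i * l j)) :
    detDeriv A t = κ * (l ⬝ᵥ evalMatDeriv A t *ᵥ r) := by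
  obtain ⟨B, hB⟩ := exists_mul_evalMat_add A t
  have h := congrArg (· * (evalMat A t).adjugate) hB
  simp only [add_mul, mul_assoc, Matrix.mul_adjugate, h0, zero_smul, mul_zero, zero_add,
    Matrix.smul_mul, one_mul] at h
  have hvec : (evalMat A t).adjugate = κ • Matrix.vecMulVec r l := by
    ext1 i j
    simp [hκ, Matrix.vecMulVec_apply]
  rw [hvec] at h
  obtain ⟨i, j, hij⟩ : ∃ i j, (evalMat A t).adjugate i j ≠ 0 := by
    by_contra! hc
    exact hadj (by ext1 i j; simpa using hc i j)
  simp only [Matrix.mul_smul, Matrix.mul_vecMulVec, Matrix.smul_mulVec,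
    Matrix.vecMulVec_mulVec] at h
  have h2 := congrFun₂ h i j
  simp only [Matrix.smul_apply, Matrix.vecMulVec_apply, smul_eq_mul, Pi.smul_apply,
    MulOpposite.smul_eq_mul_unop, MulOpposite.unop_op] at h2
  rw [hκ] at hij
  refine mul_right_cancel₀ hij ?_
  rw [← h2]
  ring

end Eval

section Local

variable {n d : ℕ}

lemma Pmat_smul (A : MatTuple n d) (t β : ℝ) :
    Pmat n d A (β * t) β = β ^ d • evalMat A t := by
  ext1 j k
  rw [Pmat, Matrix.sum_apply, Matrix.smul_apply, evalMat, Matrix.of_apply, smul_eq_mul,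
    Finset.mul_sum]
  refine Finset.sum_congr rfl fun i _ => ?_
  have hi : (i : ℕ) ≤ d := Nat.lt_succ_iff.1 i.2
  obtain ⟨e, he⟩ := Nat.exists_eq_add_of_le hi
  rw [Matrix.smul_apply, Matrix.of_apply, smul_eq_mul]
  have : d - (i : ℕ) = e := by omega
  have hpow : β ^ d = β ^ (i : ℕ) * β ^ e := by rw [← pow_add, ← he]
  rw [this, hpow]
  ring

lemma smul_Pα (A : MatTuple n d) (t β : ℝ) :
    β • Pα n d A (β * t) β = β ^ d • evalMatDeriv A t := by
  ext1 j k
  rw [Pα, Matrix.smul_apply, Matrix.sum_apply, Matrix.smul_apply, evalMatDeriv, Matrix.of_apply,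
    smul_eq_mul, smul_eq_mul, Finset.mul_sum, Finset.mul_sum]
  refine Finset.sum_congr rfl fun i _ => ?_
  have hi : (i : ℕ) ≤ d := Nat.lt_succ_iff.1 i.2
  obtain ⟨e, he⟩ := Nat.exists_eq_add_of_le hi
  rw [Matrix.smul_apply, Matrix.of_apply, smul_eq_mul]
  have : d - (i : ℕ) = e := by omega
  have hpow : β ^ d = β ^ (i : ℕ) * β ^ e := by rw [← pow_add, ← he]
  rw [this, hpow]
  have hi' : β * (((i : ℕ) : ℝ) * (β * t) ^ ((i : ℕ) - 1)) =
      β ^ (i : ℕ) * (((i : ℕ) : ℝ) * t ^ ((i : ℕ) - 1)) := by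
    cases (i : ℕ) with
    | zero => simp
    | succ m => rw [Nat.add_sub_cancel]; ring
  linear_combination (β ^ e * A i j k) * hi'

lemma smul_Pβ (A : MatTuple n d) (t β : ℝ) :
    (β * t) • Pβ n d A (β * t) β =
      β ^ d • ((d * t) • evalMat A t - t ^ 2 • evalMatDeriv A t) := by
  ext1 j k
  simp only [Pβ, Matrix.smul_apply, Matrix.sub_apply, Matrix.sum_apply, evalMat, evalMatDeriv,
    Matrix.of_apply, smul_eq_mul, Finset.mul_sum, ← Finset.sum_sub_distrib]
  refine Finset.sum_congr rfl fun i _ => ?_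
  have hi : (i : ℕ) ≤ d := Nat.lt_succ_iff.1 i.2
  have ht : t ^ 2 * (((i : ℕ) : ℝ) * t ^ ((i : ℕ) - 1)) = t * (((i : ℕ) : ℝ) * t ^ (i : ℕ)) := by
    cases (i : ℕ) with
    | zero => simp
    | succ m => rw [Nat.add_sub_cancel]; ring
  have hrhs : (d * t) * (A i j k * t ^ (i : ℕ)) -
      t ^ 2 * (A i j k * (((i : ℕ) : ℝ) * t ^ ((i : ℕ) - 1))) =
      A i j k * t * (((d : ℝ) - (i : ℕ)) * t ^ (i : ℕ)) := by
    linear_combination (-A i j k) * ht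
  rw [hrhs]
  obtain ⟨e, he⟩ := Nat.exists_eq_add_of_le hi
  have hd : (d : ℝ) = (i : ℕ) + e := by exact_mod_cast he
  have h2 : d - (i : ℕ) - 1 = e - 1 := by omega
  have hpow : β ^ d = β ^ (i : ℕ) * β ^ e := by rw [← pow_add, ← he]
  rw [h2, hd, hpow]
  clear he hd h2 hpow
  cases e with
  | zero => simp
  | succ m =>
    rw [Nat.add_sub_cancel]
    ring

lemma vvec_eq {A : MatTuple n d} {t : ℝ} (β : ℝ) {r : Fin n → ℝ} (hr : evalMat A t *ᵥ r = 0) :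
    vvec n d A (β * t) β r = (β ^ d * (1 + t ^ 2)) • (evalMatDeriv A t *ᵥ r) := by
  rw [vvec, ← Matrix.smul_mulVec, ← Matrix.smul_mulVec, smul_Pα, smul_Pβ, Matrix.smul_mulVec,
    Matrix.smul_mulVec, Matrix.sub_mulVec, Matrix.smul_mulVec, Matrix.smul_mulVec, hr]
  module

/-- The norm of the vector of monomials `(1, t, …, t ^ d)`. -/
noncomputable def monomialNorm (d : ℕ) (t : ℝ) : ℝ := √(∑ i : Fin (d + 1), (t ^ (i : ℕ)) ^ 2)

lemma sqrt_sum_eq_monomialNorm (t : ℝ) {β : ℝ} (hβ : 0 < β) :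
    √(∑ k ∈ Finset.range (d + 1), (β * t) ^ (2 * k) * β ^ (2 * (d - k))) =
      β ^ d * monomialNorm d t := by
  have hβd : 0 ≤ β ^ d := by positivity
  rw [monomialNorm]
  conv_rhs => rw [← Real.sqrt_sq hβd, ← Real.sqrt_mul (sq_nonneg _)]
  rw [Finset.mul_sum, Finset.sum_range]
  congr 1
  refine Finset.sum_congr rfl fun i _ => ?_
  have hi : (i : ℕ) ≤ d := Nat.lt_succ_iff.1 i.2
  obtain ⟨e, he⟩ := Nat.exists_eq_add_of_le hi
  have : d - (i : ℕ) = e := by omega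
  have hpow : β ^ d = β ^ (i : ℕ) * β ^ e := by rw [← pow_add, ← he]
  rw [this, hpow]
  ring

/-- The local condition number at `t`, with the norm of the adjugate matrix replaced by that of
its contraction with `u`. -/
noncomputable def condTerm (A : MatTuple n d) (u : Fin n → ℝ) (t : ℝ) : ℝ≥0∞ :=
  ENNReal.ofReal (tnorm n d A) * ENNReal.ofReal ((1 + t ^ 2)⁻¹ *
    (monomialNorm d t * vnorm n (u ᵥ* (evalMat A t).adjugate)) / |detDeriv A t|)

lemma ker_toLin'_Pmat (A : MatTuple n d) (t : ℝ) {β : ℝ} (hβ : 0 < β) :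
    LinearMap.ker (Matrix.toLin' (Pmat n d A (β * t) β)) =
      LinearMap.ker (Matrix.toLin' (evalMat A t)) := by
  rw [Pmat_smul, map_smul, LinearMap.ker_smul _ _ (by positivity)]

lemma ker_toLin'_Pmat_transpose (A : MatTuple n d) (t : ℝ) {β : ℝ} (hβ : 0 < β) :
    LinearMap.ker (Matrix.toLin' (Pmat n d A (β * t) β)ᵀ) =
      LinearMap.ker (Matrix.toLin' (evalMat A t)ᵀ) := by
  rw [Pmat_smul, Matrix.transpose_smul, map_smul, LinearMap.ker_smul _ _ (by positivity)]

lemma mulVec_eq_zero_of_ker_eq {M : Matrix (Fin n) (Fin n) ℝ} {r : Fin n → ℝ}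
    (h : LinearMap.ker (Matrix.toLin' M) = Submodule.span ℝ {r}) : M *ᵥ r = 0 := by
  have : r ∈ LinearMap.ker (Matrix.toLin' M) := h ▸ Submodule.mem_span_singleton_self r
  simpa using this

lemma exists_goodPair {A : MatTuple n d} {t β : ℝ} (hβ : 0 < β) (h0 : (evalMat A t).det = 0)
    (h1 : detDeriv A t ≠ 0) :
    ∃ p : (Fin n → ℝ) × (Fin n → ℝ), GoodPair n d A (β * t) β p.1 p.2 := by
  have hadj := adjugate_ne_zero_of_detDeriv h0 h1
  obtain ⟨i₀, j₀, hij⟩ : ∃ i j, (evalMat A t).adjugate i j ≠ 0 := by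
    by_contra! hc
    exact hadj (by ext1 i j; simpa using hc i j)
  have hr := ker_eq_span_adjugate_col h0 hij
  have hl := ker_transpose_eq_span_adjugate_row h0 hij
  have hr0 : (fun i => (evalMat A t).adjugate i j₀) ≠ 0 := fun h => hij (congrFun h i₀)
  have hl0 : (fun j => (evalMat A t).adjugate i₀ j) ≠ 0 := fun h => hij (congrFun h j₀)
  refine ⟨⟨fun i => (evalMat A t).adjugate i j₀, fun j => (evalMat A t).adjugate i₀ j⟩,
    hr0, hl0, ?_, ?_, ?_⟩
  · rw [ker_toLin'_Pmat A t hβ, hr]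
  · rw [ker_toLin'_Pmat_transpose A t hβ, hl]
  · obtain ⟨κ, hκ⟩ := exists_adjugate_eq_mul h0 hr0 hr hl
    have hf := detDeriv_eq_mul h0 hadj hκ
    simp only [vvec_eq β (mulVec_eq_zero_of_ker_eq hr)]
    change _ ⬝ᵥ _ ≠ 0
    rw [dotProduct_smul, smul_eq_mul]
    refine mul_ne_zero (by positivity) fun h => h1 ?_
    rw [hf, h, mul_zero]

lemma lintegral_condTerm {A : MatTuple n d} {t β : ℝ} (hβ : 0 < β)
    (h0 : (evalMat A t).det = 0) (h1 : detDeriv A t ≠ 0) :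
    ∫⁻ u, condTerm A u t ∂gaussPi (Fin n) =
      ENNReal.ofReal √(2 / π) * muLoc n d A (β * t) β := by
  have hex := exists_goodPair hβ h0 h1
  rw [muLoc, dif_pos hex]
  obtain ⟨hr0, -, hr, hl, hv⟩ := hex.choose_spec
  set r := hex.choose.1
  set l := hex.choose.2
  rw [ker_toLin'_Pmat A t hβ] at hr
  rw [ker_toLin'_Pmat_transpose A t hβ] at hl
  obtain ⟨κ, hκ⟩ := exists_adjugate_eq_mul h0 hr0 hr hl
  have hf := detDeriv_eq_mul h0 (adjugate_ne_zero_of_detDeriv h0 h1) hκ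
  have hκ0 : κ ≠ 0 := fun h => h1 (by rw [hf, h, zero_mul])
  have hnorm (u : Fin n → ℝ) :
      vnorm n (u ᵥ* (evalMat A t).adjugate) = |κ| * vnorm n l * |∑ i, r i * u i| := by
    have (j : Fin n) : (u ᵥ* (evalMat A t).adjugate) j = κ * (∑ i, r i * u i) * l j := by
      rw [Matrix.vecMul, dotProduct, Finset.mul_sum, Finset.sum_mul]
      refine Finset.sum_congr rfl fun i _ => ?_
      rw [hκ]
      ring
    simp only [vnorm, this, mul_pow, ← Finset.mul_sum]
    rw [Real.sqrt_mul (by positivity), ← mul_pow, Real.sqrt_sq_eq_abs, abs_mul]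
    ring
  rw [muVal, sqrt_sum_eq_monomialNorm t hβ, vvec_eq β (mulVec_eq_zero_of_ker_eq hr)]
  change _ = _ * ENNReal.ofReal (_ * (_ / |_ ⬝ᵥ _|) * _)
  rw [dotProduct_smul, smul_eq_mul]
  set D := l ⬝ᵥ evalMatDeriv A t *ᵥ r
  have hD : D ≠ 0 := fun h => h1 (by rw [hf, h, mul_zero])
  have hβd : 0 < β ^ d * (1 + t ^ 2) := by positivity
  have htn : 0 ≤ tnorm n d A := Real.sqrt_nonneg _
  have hmn : 0 ≤ monomialNorm d t := Real.sqrt_nonneg _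
  have hln : 0 ≤ vnorm n l := Real.sqrt_nonneg _
  have hterm (u : Fin n → ℝ) : condTerm A u t = ENNReal.ofReal (tnorm n d A *
      ((1 + t ^ 2)⁻¹ * monomialNorm d t * vnorm n l / |D|)) *
        ENNReal.ofReal |∑ i, r i * u i| := by
    rw [condTerm, hnorm, hf, abs_mul, ← ENNReal.ofReal_mul htn, ← ENNReal.ofReal_mul]
    · congr 1
      have : |κ| ≠ 0 := abs_ne_zero.2 hκ0
      have : |D| ≠ 0 := abs_ne_zero.2 hD
      field_simp
    · positivity
  simp_rw [hterm]
  rw [lintegral_const_mul' _ _ ENNReal.ofReal_ne_top, lintegral_abs_dot_gaussPi,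
    ← ENNReal.ofReal_mul, ← ENNReal.ofReal_mul (Real.sqrt_nonneg _), abs_mul, abs_of_pos hβd]
  · congr 1
    have : |D| ≠ 0 := abs_ne_zero.2 hD
    have : β ^ d ≠ 0 := by positivity
    rw [vnorm, vnorm]
    field_simp
  · positivity

end Local

section Total

variable {n d : ℕ}

/-- All the eigenvalues of `A` are simple and `∞` is not one of them. -/
def IsGeneric (A : MatTuple n d) : Prop :=
  (Matrix.of (A (Fin.last d))).det ≠ 0 ∧ ∀ t, (evalMat A t).det = 0 → detDeriv A t ≠ 0

lemma IsGeneric.finite_setOf_det_eq_zero {A : MatTuple n d} (hA : IsGeneric A) :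
    {t | (evalMat A t).det = 0}.Finite := by
  have h0 : detPoly A ≠ 0 := by
    intro h
    refine hA.2 0 ?_ ?_
    · rw [← detPoly_eval, h, Polynomial.eval_zero]
    · rw [detDeriv, h, Polynomial.derivative_zero, Polynomial.eval_zero]
  refine (Polynomial.finite_setOfPred_isRoot h0).subset fun t ht => ?_
  rw [Set.mem_ofPred_eq, Polynomial.IsRoot, detPoly_eval]
  exact ht

lemma Pmat_one_zero (A : MatTuple n d) : Pmat n d A 1 0 = Matrix.of (A (Fin.last d)) := by
  rw [Pmat, Finset.sum_eq_single (Fin.last d)]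
  · simp
  · intro i _ hi
    have : d - (i : ℕ) ≠ 0 := by
      have := Fin.val_lt_last hi
      omega
    simp [zero_pow this]
  · simp

lemma IsGeneric.snd_pos {A : MatTuple n d} (hA : IsGeneric A) {x : ℝ × ℝ}
    (hx : x ∈ pevReps n d A) : 0 < x.2 := by
  obtain ⟨⟨-, h | ⟨h2, h1⟩⟩, hdet⟩ := hx
  · exact h
  · rw [IsPEV, h1, h2, Pmat_one_zero] at hdet
    exact absurd hdet hA.1

lemma isPEV_iff (A : MatTuple n d) (t : ℝ) {β : ℝ} (hβ : 0 < β) :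
    IsPEV n d A (β * t) β ↔ (evalMat A t).det = 0 := by
  rw [IsPEV, Pmat_smul, Matrix.det_smul, mul_eq_zero, or_iff_right]
  positivity

/-- The affine parametrization of the eigenvalues of a generic tuple. -/
noncomputable def IsGeneric.pevRepsEquiv {A : MatTuple n d} (hA : IsGeneric A) :
    {t // (evalMat A t).det = 0} ≃ pevReps n d A where
  toFun t := ⟨((√(1 + t.1 ^ 2))⁻¹ * t.1, (√(1 + t.1 ^ 2))⁻¹), by
    have h : 0 < 1 + t.1 ^ 2 := by positivity
    have hβ : 0 < (√(1 + t.1 ^ 2))⁻¹ := inv_pos.2 (Real.sqrt_pos.2 h)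
    refine ⟨⟨?_, Or.inl hβ⟩, (isPEV_iff A t.1 hβ).2 t.2⟩
    simp only [mul_pow, inv_pow, Real.sq_sqrt h.le]
    field_simp
    ring⟩
  invFun x := ⟨x.1.1 / x.1.2, by
    have hβ := hA.snd_pos x.2
    rw [← isPEV_iff A _ hβ, mul_div_cancel₀ _ hβ.ne']
    exact x.2.2⟩
  left_inv t := by
    have hβ : (√(1 + t.1 ^ 2))⁻¹ ≠ 0 := by positivity
    exact Subtype.ext (mul_div_cancel_left₀ _ hβ)
  right_inv x := by
    have hβ := hA.snd_pos x.2
    have hs : √(1 + (x.1.1 / x.1.2) ^ 2) = x.1.2⁻¹ := by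
      rw [← Real.sqrt_sq (inv_pos.2 hβ).le]
      congr 1
      have := x.2.1.1
      field_simp
      linarith
    refine Subtype.ext (Prod.ext ?_ ?_)
    · change (√(1 + (x.1.1 / x.1.2) ^ 2))⁻¹ * (x.1.1 / x.1.2) = x.1.1
      rw [hs, inv_inv, mul_div_cancel₀ _ hβ.ne']
    · change (√(1 + (x.1.1 / x.1.2) ^ 2))⁻¹ = x.1.2
      rw [hs, inv_inv]

lemma IsGeneric.muTotal_eq {A : MatTuple n d} (hA : IsGeneric A) :
    muTotal n d A = ∑' t : {t // (evalMat A t).det = 0},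
      muLoc n d A ((√(1 + t.1 ^ 2))⁻¹ * t.1) (√(1 + t.1 ^ 2))⁻¹ := by
  have hfin : (pevReps n d A).Finite := by
    have : Finite {t // (evalMat A t).det = 0} := hA.finite_setOf_det_eq_zero
    exact Finite.of_equiv _ hA.pevRepsEquiv
  rw [muTotal, if_neg (Set.not_infinite.2 hfin), ← hA.pevRepsEquiv.tsum_eq]
  rfl

lemma measurable_condTerm_left (A : MatTuple n d) (t : ℝ) :
    Measurable fun u => condTerm A u t := by
  unfold condTerm vnorm Matrix.vecMul dotProduct
  fun_prop

lemma IsGeneric.lintegral_tsum_condTerm {A : MatTuple n d} (hA : IsGeneric A) :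
    ∫⁻ u, ∑' t : {t // (evalMat A t).det = 0}, condTerm A u t ∂gaussPi (Fin n) =
      ENNReal.ofReal √(2 / π) * muTotal n d A := by
  have : Finite {t // (evalMat A t).det = 0} := hA.finite_setOf_det_eq_zero
  rw [lintegral_tsum (f := fun (t : {t // (evalMat A t).det = 0}) u => condTerm A u t)
    fun t => (measurable_condTerm_left A t).aemeasurable, hA.muTotal_eq, ← ENNReal.tsum_mul_left]
  refine tsum_congr fun t => lintegral_condTerm (by positivity) t.2 (hA.2 _ t.2)

end Total

section Reindex

variable {ι κ : Type*} [Fintype ι] [Fintype κ]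

lemma measurePreserving_gaussPi_comp (e : ι ≃ κ) :
    MeasurePreserving (fun (x : κ → ℝ) i => x (e i)) (gaussPi κ) (gaussPi ι) := by
  have h := measurePreserving_piCongrLeft (α := fun _ : ι => ℝ) (fun _ => gaussianReal 0 1) e.symm
  convert h using 1
  funext x i
  have := MeasurableEquiv.piCongrLeft_apply_apply (β := fun _ : ι => ℝ) e.symm x (e i)
  simpa using this.symm

lemma measurePreserving_gaussPi_sumElim :
    MeasurePreserving (fun p : (ι → ℝ) × (κ → ℝ) => Sum.elim p.1 p.2)
      ((gaussPi ι).prod (gaussPi κ)) (gaussPi (ι ⊕ κ)) := by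
  have h := measurePreserving_sumPiEquivProdPi_symm (X := fun _ : ι ⊕ κ => ℝ)
    (fun _ => gaussianReal 0 1)
  convert h using 1
  funext p i
  cases i <;> rfl

lemma measurePreserving_gaussPi_curry :
    MeasurePreserving (fun (x : ι × κ → ℝ) i j => x (i, j)) (gaussPi (ι × κ))
      (Measure.pi fun _ : ι => gaussPi κ) := by
  refine ⟨by fun_prop, ?_⟩
  have := Measure.infinitePi_map_curry (fun (_ : ι) (_ : κ) => gaussianReal 0 1)
  simp only [Measure.infinitePi_eq_pi] at this
  exact this

lemma measurePreserving_toTuple (n d : ℕ) :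
    MeasurePreserving (toTuple (n := n) (d := d) (R := ℝ))
      (gaussPi (Fin (d + 1) × Fin n × Fin n)) (gaussTuple n d) :=
  (measurePreserving_pi _ _ fun _ : Fin (d + 1) =>
    measurePreserving_gaussPi_curry (ι := Fin n) (κ := Fin n)).comp
      measurePreserving_gaussPi_curry

instance (n d : ℕ) : IsProbabilityMeasure (gaussTuple n d) := by
  unfold gaussTuple; infer_instance

end Reindex

section Rotate

variable {n d : ℕ}

/-- Right multiplication of all the matrices of a tuple by `O`. -/
noncomputable def rotate (O : Matrix (Fin n) (Fin n) ℝ) (A : MatTuple n d) : MatTuple n d :=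
  fun i j => Oᵀ *ᵥ A i j

lemma measurePreserving_rotate {O : Matrix (Fin n) (Fin n) ℝ} (hO : Oᵀ * O = 1) :
    MeasurePreserving (rotate (d := d) O) (gaussTuple n d) (gaussTuple n d) := by
  have hO2 : O * Oᵀ = 1 := mul_eq_one_comm.1 hO
  have h := measurePreserving_gaussPi_mulVec Oᵀ (by
    rw [Matrix.transpose_transpose]
    convert hO2)
  exact measurePreserving_pi _ _ fun _ => measurePreserving_pi _ _ fun _ => h

lemma tnorm_rotate {O : Matrix (Fin n) (Fin n) ℝ} (hO : Oᵀ * O = 1) (A : MatTuple n d) :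
    tnorm n d (rotate O A) = tnorm n d A := by
  have h (v : Fin n → ℝ) : ∑ k, (Oᵀ *ᵥ v) k ^ 2 = ∑ k, v k ^ 2 := by
    have : (Oᵀ *ᵥ v) ⬝ᵥ (Oᵀ *ᵥ v) = v ⬝ᵥ v := by
      rw [Matrix.dotProduct_mulVec, Matrix.vecMul_transpose, Matrix.mulVec_mulVec,
        mul_eq_one_comm.1 hO, Matrix.one_mulVec]
    simpa only [dotProduct, ← pow_two] using this
  simp only [tnorm, rotate, h]

lemma polyMat_rotate (O : Matrix (Fin n) (Fin n) ℝ) (A : MatTuple n d) :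
    polyMat (rotate O A) = polyMat A * O.map Polynomial.C := by
  ext1 j k
  simp only [polyMat, rotate, Matrix.of_apply, Matrix.mul_apply, Matrix.map_apply,
    Matrix.mulVec, dotProduct, Matrix.transpose_apply, map_sum, map_mul, Finset.sum_mul]
  rw [Finset.sum_comm]
  refine Finset.sum_congr rfl fun _ _ => Finset.sum_congr rfl fun _ _ => ?_
  ring

lemma detPoly_rotate (O : Matrix (Fin n) (Fin n) ℝ) (A : MatTuple n d) :
    detPoly (rotate O A) = detPoly A * Polynomial.C O.det := by
  rw [detPoly, polyMat_rotate, Matrix.det_mul, detPoly, RingHom.map_det, RingHom.mapMatrix_apply]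

lemma evalMat_rotate (O : Matrix (Fin n) (Fin n) ℝ) (A : MatTuple n d) (t : ℝ) :
    evalMat (rotate O A) t = evalMat A t * O := by
  rw [← polyMat_eval, polyMat_rotate, map_mul, polyMat_eval]
  congr 1
  ext1 j k
  simp

lemma detDeriv_rotate (O : Matrix (Fin n) (Fin n) ℝ) (A : MatTuple n d) (t : ℝ) :
    detDeriv (rotate O A) t = detDeriv A t * O.det := by
  simp [detDeriv, detPoly_rotate, Polynomial.derivative_mul]

lemma vnorm_smul (c : ℝ) (v : Fin n → ℝ) : vnorm n (c • v) = |c| * vnorm n v := by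
  simp only [vnorm, Pi.smul_apply, smul_eq_mul, mul_pow, ← Finset.mul_sum]
  rw [Real.sqrt_mul (sq_nonneg c), Real.sqrt_sq_eq_abs]

lemma abs_det_of_transpose_mul_self {O : Matrix (Fin n) (Fin n) ℝ} (hO : Oᵀ * O = 1) :
    |O.det| = 1 := by
  have h := congrArg Matrix.det hO
  rw [Matrix.det_mul, Matrix.det_transpose, Matrix.det_one] at h
  rwa [← abs_mul_abs_self, mul_self_eq_one_iff, or_iff_left] at h
  linarith [abs_nonneg O.det]

lemma condTerm_smul (A : MatTuple n d) (c : ℝ) (u : Fin n → ℝ) (t : ℝ) :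
    condTerm A (c • u) t = ENNReal.ofReal |c| * condTerm A u t := by
  rw [condTerm, condTerm, Matrix.smul_vecMul, vnorm_smul,
    mul_left_comm (ENNReal.ofReal |c|), ← ENNReal.ofReal_mul (abs_nonneg c)]
  congr 2
  ring

lemma condTerm_rotate {O : Matrix (Fin n) (Fin n) ℝ} (hO : Oᵀ * O = 1) (A : MatTuple n d)
    (u : Fin n → ℝ) (t : ℝ) : condTerm (rotate O A) u t = condTerm A (O *ᵥ u) t := by
  have hadj : O.adjugate = O.det • Oᵀ := by
    calc O.adjugate = (Oᵀ * O) * O.adjugate := by rw [hO, one_mul]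
      _ = O.det • Oᵀ := by rw [mul_assoc, Matrix.mul_adjugate, Matrix.mul_smul, mul_one]
  rw [condTerm, condTerm, tnorm_rotate hO, evalMat_rotate, detDeriv_rotate, abs_mul,
    Matrix.adjugate_mul_distrib, hadj, Matrix.smul_mul, Matrix.vecMul_smul, vnorm_smul,
    abs_det_of_transpose_mul_self hO, mul_one, one_mul, ← Matrix.vecMul_vecMul,
    Matrix.vecMul_transpose]

/-- The sum of the contracted local condition numbers over all finite eigenvalues. -/
noncomputable def condSum (A : MatTuple n d) (u : Fin n → ℝ) : ℝ≥0∞ :=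
  ∑' t : {t // (evalMat A t).det = 0}, condTerm A u t

lemma condSum_smul (A : MatTuple n d) (c : ℝ) (u : Fin n → ℝ) :
    condSum A (c • u) = ENNReal.ofReal |c| * condSum A u := by
  rw [condSum, condSum, ← ENNReal.tsum_mul_left]
  exact tsum_congr fun t => condTerm_smul A c u t

lemma condSum_rotate {O : Matrix (Fin n) (Fin n) ℝ} (hO : Oᵀ * O = 1) (A : MatTuple n d)
    (u : Fin n → ℝ) : condSum (rotate O A) u = condSum A (O *ᵥ u) := by
  have hdet : O.det ≠ 0 := fun h => by
    have := abs_det_of_transpose_mul_self hO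
    simp [h] at this
  have h (t : ℝ) : (evalMat A t).det = 0 ↔ (evalMat (rotate O A) t).det = 0 := by
    rw [evalMat_rotate, Matrix.det_mul, mul_eq_zero, or_iff_left hdet]
  rw [condSum, condSum, ← (Equiv.subtypeEquivRight h).tsum_eq]
  exact tsum_congr fun t => condTerm_rotate hO A u t

lemma continuous_evalMat : Continuous fun p : MatTuple n d × ℝ => evalMat p.1 p.2 := by
  unfold evalMat
  refine continuous_matrix fun j k => ?_
  simp only [Matrix.of_apply]
  fun_prop

lemma continuous_coeff_detPoly (m : ℕ) :
    Continuous fun A : MatTuple n d => (detPoly A).coeff m := by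
  have h (A : MatTuple n d) : (detPoly A).coeff m =
      MvPolynomial.eval (fun q : Fin (d + 1) × Fin n × Fin n => A q.1 q.2.1 q.2.2)
        ((detPoly (toTuple MvPolynomial.X)).coeff m) := by
    rw [← Polynomial.coeff_map, detPoly_map]
    simp
  simp only [h]
  exact (MvPolynomial.continuous_eval _).comp (by fun_prop)

lemma continuous_detDeriv (t : ℝ) : Continuous fun A : MatTuple n d => detDeriv A t := by
  have h (A : MatTuple n d) : detDeriv A t =
      ∑ m ∈ Finset.range (n * d + 1), (detPoly A).coeff m * (m * t ^ (m - 1)) := by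
    rw [detDeriv, Polynomial.derivative_eval,
      Polynomial.sum_over_range' _ (by simp) _ (Nat.lt_succ_of_le (natDegree_detPoly_le A))]
    simp only [mul_assoc]
  simp only [h]
  exact continuous_finsetSum _ fun m _ => (continuous_coeff_detPoly m).mul continuous_const

lemma aemeasurable_condSum {X : Type*} [TopologicalSpace X] [MeasurableSpace X]
    [OpensMeasurableSpace X] {μ : Measure X} {a : X → MatTuple n d} {b : X → Fin n → ℝ}
    (ha : Continuous a) (hb : Continuous b) (hgen : ∀ᵐ x ∂μ, IsGeneric (a x)) :
    AEMeasurable (fun x => condSum (a x) (b x)) μ := by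
  refine aemeasurable_tsum_zeros (F := fun x t => (evalMat (a x) t).det)
    (q := fun x t => condTerm (a x) (b x) t) ?_ (fun t => ?_)
    (hgen.mono fun x hx => hx.finite_setOf_det_eq_zero) (hgen.mono fun x hx t ht => ?_)
  · exact (continuous_evalMat.comp ((ha.comp continuous_fst).prodMk continuous_snd)).matrix_det
  · have h1 : Continuous fun x => evalMat (a x) t :=
      continuous_evalMat.comp (ha.prodMk continuous_const)
    have h2 : Continuous fun x => vnorm n (b x ᵥ* (evalMat (a x) t).adjugate) := by
      have := hb.matrix_vecMul h1.matrix_adjugate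
      unfold vnorm
      fun_prop
    have h3 : Continuous fun x => tnorm n d (a x) := by
      unfold tnorm
      fun_prop
    have h4 : Measurable fun x => detDeriv (a x) t :=
      ((continuous_detDeriv t).comp ha).measurable
    have h5 := h2.measurable
    have h6 := h3.measurable
    unfold condTerm
    fun_prop
  · have h1 : Continuous fun s => evalMat (a x) s :=
      continuous_evalMat.comp (continuous_const.prodMk continuous_id)
    have h2 : Continuous fun s => vnorm n (b x ᵥ* (evalMat (a x) s).adjugate) := by
      have := (continuous_const (y := b x)).matrix_vecMul h1.matrix_adjugate
      unfold vnorm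
      fun_prop
    have h3 : Continuous fun s => |detDeriv (a x) s| :=
      (Polynomial.continuous _).abs
    have h4 : Continuous (monomialNorm d) := by
      unfold monomialNorm
      fun_prop
    have h5 : Continuous fun s : ℝ => (1 + s ^ 2)⁻¹ :=
      (by fun_prop : Continuous fun s : ℝ => 1 + s ^ 2).inv₀ fun s => by positivity
    refine ENNReal.Tendsto.const_mul ?_ (Or.inr ENNReal.ofReal_ne_top)
    refine (ENNReal.continuous_ofReal.continuousAt.comp (x := t) ?_).tendsto
    exact (h5.mul (h4.mul h2)).continuousAt.div h3.continuousAt (abs_ne_zero.2 (hx.2 t ht))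

lemma ae_isGeneric (hn : n ≠ 0) (hd : d ≠ 0) : ∀ᵐ A ∂gaussTuple n d, IsGeneric A := by
  rw [← (measurePreserving_toTuple n d).map_eq]
  have he : MeasurableEmbedding (toTuple (n := n) (d := d) (R := ℝ)) :=
    Continuous.measurableEmbedding (by unfold toTuple; fun_prop) fun x y hxy => by
      funext q
      exact congrFun₂ (congrFun hxy q.1) q.2.1 q.2.2
  rw [he.ae_map_iff]
  filter_upwards [ae_detDisc_ne_zero hd, ae_det_ne_zero (Fin.last d)] with x hx1 hx2
  refine ⟨hx2, fun t ht => ?_⟩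
  rw [← detPoly_eval] at ht
  exact eval_derivative_ne_zero_of_detDisc (mul_ne_zero hn hd) hx1 ht

lemma lintegral_condSum (hn : n ≠ 0) (hd : d ≠ 0) (i₀ : Fin n) (u : Fin n → ℝ) :
    ∫⁻ A, condSum A u ∂gaussTuple n d = ENNReal.ofReal √(∑ i, u i ^ 2) *
      ∫⁻ A, condSum A (Pi.single i₀ 1) ∂gaussTuple n d := by
  by_cases hu : ∑ i, u i ^ 2 = 0
  · have : u = (0 : ℝ) • u := by
      rw [Finset.sum_eq_zero_iff_of_nonneg fun i _ => sq_nonneg (u i)] at hu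
      funext i
      simpa using hu i (Finset.mem_univ i)
    rw [this]
    simp only [condSum_smul]
    simp
  · set ρ := √(∑ i, u i ^ 2) with hρ
    have hρ2 : ρ ^ 2 = ∑ i, u i ^ 2 :=
      Real.sq_sqrt (Finset.sum_nonneg fun i _ => sq_nonneg (u i))
    have hρ0 : ρ ≠ 0 := fun h => hu (by rw [← hρ2, h]; simp)
    obtain ⟨O, hO, hOu⟩ := exists_orthogonal_mulVec_single i₀ (ρ⁻¹ • u) (by
      simp only [Pi.smul_apply, smul_eq_mul, mul_pow, ← Finset.mul_sum, ← hρ2]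
      field_simp)
    have hcol : O *ᵥ Pi.single i₀ 1 = ρ⁻¹ • u := by
      rw [Matrix.mulVec_single_one]
      exact funext hOu
    have hu' : u = ρ • (O *ᵥ Pi.single i₀ 1) := by rw [hcol, smul_inv_smul₀ hρ0]
    have hmeas : AEMeasurable (fun A : MatTuple n d => condSum A (Pi.single i₀ 1))
        (gaussTuple n d) := aemeasurable_condSum continuous_id continuous_const
      (ae_isGeneric hn hd)
    conv_lhs => rw [hu']
    simp only [condSum_smul, ← condSum_rotate hO]
    rw [lintegral_const_mul' _ _ ENNReal.ofReal_ne_top, abs_of_nonneg (Real.sqrt_nonneg _)]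
    congr 1
    have hmp := measurePreserving_rotate (n := n) (d := d) hO
    rw [← hmp.map_eq] at hmeas
    rw [← lintegral_map' hmeas hmp.measurable.aemeasurable, hmp.map_eq]

end Rotate

lemma adjugate_congr_of_forall_ne {ι R : Type*} [Fintype ι] [DecidableEq ι] [CommRing R]
    {M N : Matrix ι ι R} {i₀ : ι} (h : ∀ j k, k ≠ i₀ → M j k = N j k) (j : ι) :
    M.adjugate i₀ j = N.adjugate i₀ j := by
  have key (P : Matrix ι ι R) :
      P.adjugate i₀ j = (Pᵀ.updateRow i₀ (Pi.single j 1)).det := by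
    rw [← Matrix.adjugate_apply, ← Matrix.adjugate_transpose, Matrix.transpose_apply]
  rw [key, key]
  congr 1
  ext1 k l
  by_cases hk : k = i₀
  · subst hk
    simp
  · rw [Matrix.updateRow_ne hk, Matrix.updateRow_ne hk]
    exact h l k hk

section Column

variable {n d : ℕ} {i₀ : Fin n}

/-- The indices of the entries outside of the column `i₀`. -/
abbrev OffColumn (d : ℕ) {n : ℕ} (i₀ : Fin n) : Type := Fin (d + 1) × Fin n × {k // k ≠ i₀}

/-- The tuple with entries `y` in the column `i₀` and `z` elsewhere. -/
noncomputable def glue (z : OffColumn d i₀ → ℝ) (y : Fin (d + 1) × Fin n → ℝ) : MatTuple n d :=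
  fun i j k => if h : k = i₀ then y (i, j) else z (i, j, ⟨k, h⟩)

/-- Splitting the entries of a tuple according to their column. -/
noncomputable def columnEquiv (d : ℕ) {n : ℕ} (i₀ : Fin n) :
    Fin (d + 1) × Fin n × Fin n ≃ OffColumn d i₀ ⊕ Fin (d + 1) × Fin n where
  toFun q := if h : q.2.2 = i₀ then Sum.inr (q.1, q.2.1) else Sum.inl (q.1, q.2.1, ⟨q.2.2, h⟩)
  invFun := Sum.elim (fun z => (z.1, z.2.1, z.2.2.1)) fun y => (y.1, y.2, i₀)
  left_inv q := by
    obtain ⟨i, j, k⟩ := q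
    by_cases h : k = i₀
    · subst h
      simp
    · simp [h]
  right_inv s := by
    rcases s with ⟨i, j, k⟩ | y
    · simp [k.2]
    · simp

lemma glue_apply (z : OffColumn d i₀ → ℝ) (y : Fin (d + 1) × Fin n → ℝ)
    (i : Fin (d + 1)) (j k : Fin n) :
    glue z y i j k = Sum.elim z y (columnEquiv d i₀ (i, j, k)) := by
  by_cases h : k = i₀ <;> simp [glue, columnEquiv, h]

lemma measurePreserving_glue :
    MeasurePreserving (fun p : (OffColumn d i₀ → ℝ) × (Fin (d + 1) × Fin n → ℝ) => glue p.1 p.2)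
      ((gaussPi (OffColumn d i₀)).prod (gaussPi (Fin (d + 1) × Fin n))) (gaussTuple n d) := by
  have h := (measurePreserving_toTuple n d).comp
    ((measurePreserving_gaussPi_comp (columnEquiv d i₀)).comp measurePreserving_gaussPi_sumElim)
  convert h using 1
  funext p i j k
  exact glue_apply _ _ _ _ _

lemma continuous_glue :
    Continuous fun p : (OffColumn d i₀ → ℝ) × (Fin (d + 1) × Fin n → ℝ) => glue p.1 p.2 := by
  refine continuous_pi fun i => continuous_pi fun j => continuous_pi fun k => ?_
  by_cases h : k = i₀
  · simp only [glue, h, dite_true]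
    fun_prop
  · simp only [glue, h, dite_false]
    fun_prop

lemma tnorm_glue (z : OffColumn d i₀ → ℝ) (y : Fin (d + 1) × Fin n → ℝ) :
    tnorm n d (glue z y) = √(∑ q, z q ^ 2 + ∑ q, y q ^ 2) := by
  rw [tnorm]
  congr 1
  have h := (columnEquiv d i₀).sum_comp fun s => Sum.elim z y s ^ 2
  rw [Fintype.sum_sum_type, Fintype.sum_prod_type] at h
  simp only [Sum.elim_inl, Sum.elim_inr] at h
  rw [← h]
  refine Finset.sum_congr rfl fun i _ => ?_
  rw [Fintype.sum_prod_type]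
  simp only [glue_apply]

/-- The coefficient of the entry `q` of the column `i₀` in the determinant polynomial. -/
noncomputable def colPoly (z : OffColumn d i₀ → ℝ) (q : Fin (d + 1) × Fin n) : Polynomial ℝ :=
  Polynomial.X ^ (q.1 : ℕ) * (polyMat (glue z 0)).adjugate i₀ q.2

lemma adjugate_polyMat_glue (z : OffColumn d i₀ → ℝ) (y : Fin (d + 1) × Fin n → ℝ)
    (j : Fin n) :
    (polyMat (glue z y)).adjugate i₀ j = (polyMat (glue z 0)).adjugate i₀ j := by
  refine adjugate_congr_of_forall_ne (fun j k hk => ?_) j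
  simp [polyMat, glue, hk]

lemma adjugate_evalMat_glue (z : OffColumn d i₀ → ℝ) (y : Fin (d + 1) × Fin n → ℝ)
    (j : Fin n) (t : ℝ) :
    (evalMat (glue z y) t).adjugate i₀ j = ((polyMat (glue z 0)).adjugate i₀ j).eval t := by
  rw [← adjugate_polyMat_glue z y, ← adjugate_polyMat_eval]
  rfl

lemma detPoly_glue (z : OffColumn d i₀ → ℝ) (y : Fin (d + 1) × Fin n → ℝ) :
    detPoly (glue z y) = ∑ q, Polynomial.C (y q) * colPoly z q := by
  have h := congrFun₂ (polyMat (glue z y)).adjugate_mul i₀ i₀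
  rw [Matrix.smul_apply, Matrix.one_apply_eq, smul_eq_mul, mul_one, Matrix.mul_apply] at h
  rw [detPoly, ← h, Fintype.sum_prod_type, Finset.sum_comm]
  refine Finset.sum_congr rfl fun j _ => ?_
  have hcol : polyMat (glue z y) j i₀ =
      ∑ i : Fin (d + 1), Polynomial.C (y (i, j)) * Polynomial.X ^ (i : ℕ) := by
    simp [polyMat, glue]
  rw [adjugate_polyMat_glue, hcol, Finset.mul_sum]
  refine Finset.sum_congr rfl fun i _ => ?_
  rw [colPoly]
  ring

lemma det_evalMat_glue (z : OffColumn d i₀ → ℝ) (y : Fin (d + 1) × Fin n → ℝ) (t : ℝ) :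
    (evalMat (glue z y) t).det = ∑ q, y q * (colPoly z q).eval t := by
  rw [← detPoly_eval, detPoly_glue, Polynomial.eval_finsetSum]
  simp

lemma detDeriv_glue (z : OffColumn d i₀ → ℝ) (y : Fin (d + 1) × Fin n → ℝ) (t : ℝ) :
    detDeriv (glue z y) t = ∑ q, y q * (Polynomial.derivative (colPoly z q)).eval t := by
  rw [detDeriv, detPoly_glue, Polynomial.derivative_sum, Polynomial.eval_finsetSum]
  simp

lemma sqrt_sum_colPoly (z : OffColumn d i₀ → ℝ) (y : Fin (d + 1) × Fin n → ℝ) (t : ℝ) :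
    √(∑ q, (colPoly z q).eval t ^ 2) = monomialNorm d t *
      vnorm n (Pi.single i₀ 1 ᵥ* (evalMat (glue z y) t).adjugate) := by
  rw [monomialNorm, vnorm, ← Real.sqrt_mul (by positivity), Matrix.single_one_vecMul,
    Finset.sum_mul_sum, Fintype.sum_prod_type]
  congr 1
  refine Finset.sum_congr rfl fun i _ => Finset.sum_congr rfl fun j _ => ?_
  rw [Matrix.row_apply, adjugate_evalMat_glue, colPoly, Polynomial.eval_mul, Polynomial.eval_pow,
    Polynomial.eval_X, mul_pow]

lemma condSum_glue (z : OffColumn d i₀ → ℝ) (y : Fin (d + 1) × Fin n → ℝ) :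
    condSum (glue z y) (Pi.single i₀ 1) = ∑' t : {t // ∑ q, y q * (colPoly z q).eval t = 0},
      zeroWeight (fun q t => (colPoly z q).eval t)
        (fun q t => (Polynomial.derivative (colPoly z q)).eval t)
        (fun s => √(∑ q, z q ^ 2 + s)) y t := by
  rw [condSum, ← (Equiv.subtypeEquivRight fun t => by
    rw [det_evalMat_glue z y t]).tsum_eq]
  refine tsum_congr fun t => ?_
  rw [condTerm, zeroWeight, tnorm_glue, sqrt_sum_colPoly z y, detDeriv_glue]
  rfl

lemma evalMat_zero (A : MatTuple n d) : evalMat A 0 = Matrix.of (A 0) := by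
  ext1 j k
  rw [evalMat, Matrix.of_apply, Finset.sum_eq_single 0]
  · simp
  · intro i _ hi
    have : (i : ℕ) ≠ 0 := fun h => hi (Fin.ext h)
    simp [this]
  · simp

lemma ae_adjugate_ne_zero_gaussTuple (i₀ : Fin n) :
    ∀ᵐ A ∂gaussTuple n d, (Matrix.of (A 0)).adjugate i₀ i₀ ≠ 0 := by
  have hc : Continuous fun A : MatTuple n d => (Matrix.of (A 0)).adjugate i₀ i₀ := by
    have : Continuous fun A : MatTuple n d => (Matrix.of (A 0) : Matrix (Fin n) (Fin n) ℝ) :=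
      continuous_matrix fun j k => by
        simp only [Matrix.of_apply]
        fun_prop
    exact this.matrix_adjugate.matrix_elem i₀ i₀
  rw [← (measurePreserving_toTuple n d).map_eq]
  exact (ae_map_iff (measurePreserving_toTuple n d).measurable.aemeasurable
    (hc.measurable (measurableSet_singleton 0).compl)).2 (ae_adjugate_ne_zero 0 i₀)

lemma lintegral_condSum_glue (hd : d ≠ 0) {z : OffColumn d i₀ → ℝ}
    (hgen : ∀ᵐ y ∂gaussPi (Fin (d + 1) × Fin n), IsGeneric (glue z y))
    (hadj : ∀ᵐ y ∂gaussPi (Fin (d + 1) × Fin n),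
      (Matrix.of (glue z y 0)).adjugate i₀ i₀ ≠ 0) :
    ∫⁻ y, condSum (glue z y) (Pi.single i₀ 1) ∂gaussPi (Fin (d + 1) × Fin n) =
      ENNReal.ofReal π * (ENNReal.ofReal (√(2 * π))⁻¹ *
        ∫⁻ y, ENNReal.ofReal √(∑ q, z q ^ 2 + ∑ q, y q ^ 2)
          ∂gaussPi {q : Fin (d + 1) × Fin n // q ≠ (0, i₀)}) := by
  simp only [condSum_glue]
  have hq₀ : colPoly z (0, i₀) = (polyMat (glue z 0)).adjugate i₀ i₀ := by simp [colPoly]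
  refine Eq.trans (lintegral_tsum_zeroWeight (0, i₀)
    (w := fun q t => (colPoly z q).eval t)
    (w' := fun q t => (Polynomial.derivative (colPoly z q)).eval t)
    (h := fun s => √(∑ q, z q ^ 2 + s))
    (fun q => (colPoly z q).continuous) (fun q => Polynomial.continuous _)
    (fun q t => (colPoly z q).hasStrictDerivAt t) (by fun_prop) ?_ (fun t ht => ?_) ?_ ?_) ?_
  · obtain ⟨y, hy⟩ := hadj.exists
    have hne : colPoly z (0, i₀) ≠ 0 := by
      intro h
      refine hy ?_
      rw [← evalMat_zero, adjugate_evalMat_glue, ← hq₀, h, Polynomial.eval_zero]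
    exact Polynomial.finite_setOfPred_isRoot hne
  · refine ⟨(⟨1, by omega⟩, i₀), ?_⟩
    have h1 : colPoly z (⟨1, by omega⟩, i₀) = Polynomial.X * colPoly z (0, i₀) := by
      rw [hq₀]
      simp [colPoly]
    rw [h1]
    simp only [Polynomial.derivative_mul, Polynomial.derivative_X, Polynomial.eval_add,
      Polynomial.eval_mul, Polynomial.eval_X, one_mul]
    ring_nf
    exact pow_ne_zero 2 ht
  · filter_upwards [hgen] with y hy
    simpa only [det_evalMat_glue] using hy.finite_setOf_det_eq_zero
  · filter_upwards [hgen] with y hy t ht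
    rw [← detDeriv_glue]
    refine hy.2 t ?_
    rw [det_evalMat_glue]
    exact ht
  · congr!

lemma lintegral_condSum_single (hd : d ≠ 0) (i₀ : Fin n) :
    ∫⁻ A, condSum A (Pi.single i₀ 1) ∂gaussTuple n d =
      ENNReal.ofReal (π * (√(2 * π))⁻¹ * chiMean ((d + 1) * n ^ 2 - 1)) := by
  have hn : n ≠ 0 := fun h => (h ▸ i₀).elim0
  have hmp := measurePreserving_glue (d := d) (i₀ := i₀)
  have hgen : ∀ᵐ p ∂(gaussPi (OffColumn d i₀)).prod (gaussPi (Fin (d + 1) × Fin n)),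
      IsGeneric (glue p.1 p.2) := hmp.quasiMeasurePreserving.ae (ae_isGeneric hn hd)
  have hadj : ∀ᵐ p ∂(gaussPi (OffColumn d i₀)).prod (gaussPi (Fin (d + 1) × Fin n)),
      (Matrix.of (glue p.1 p.2 0)).adjugate i₀ i₀ ≠ 0 :=
    hmp.quasiMeasurePreserving.ae (ae_adjugate_ne_zero_gaussTuple i₀)
  have hmeas : AEMeasurable (fun A : MatTuple n d => condSum A (Pi.single i₀ 1))
    (gaussTuple n d) := aemeasurable_condSum continuous_id continuous_const (ae_isGeneric hn hd)
  have hmeas2 : AEMeasurable (fun A : MatTuple n d => condSum A (Pi.single i₀ 1))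
    (((gaussPi (OffColumn d i₀)).prod (gaussPi (Fin (d + 1) × Fin n))).map
      fun p => glue p.1 p.2) := by rwa [hmp.map_eq]
  rw [← hmp.map_eq, lintegral_map' hmeas2 hmp.measurable.aemeasurable, lintegral_prod _
    (aemeasurable_condSum continuous_glue continuous_const hgen)]
  have hz : ∀ᵐ z ∂gaussPi (OffColumn d i₀),
      ∫⁻ y, condSum (glue z y) (Pi.single i₀ 1) ∂gaussPi (Fin (d + 1) × Fin n) =
      ENNReal.ofReal π * (ENNReal.ofReal (√(2 * π))⁻¹ *
        ∫⁻ y, ENNReal.ofReal √(∑ q, z q ^ 2 + ∑ q, y q ^ 2)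
          ∂gaussPi {q : Fin (d + 1) × Fin n // q ≠ (0, i₀)}) := by
    filter_upwards [Measure.ae_ae_of_ae_prod hgen, Measure.ae_ae_of_ae_prod hadj]
      with z h1 h2 using lintegral_condSum_glue hd h1 h2
  rw [lintegral_congr_ae hz, lintegral_const_mul' _ _ ENNReal.ofReal_ne_top,
    lintegral_const_mul' _ _ ENNReal.ofReal_ne_top, ← mul_assoc,
    ← ENNReal.ofReal_mul Real.pi_pos.le,
    ENNReal.ofReal_mul (p := π * (√(2 * π))⁻¹) (by positivity)]
  congr 1
  have hne : Nonempty (OffColumn d i₀ ⊕ {q : Fin (d + 1) × Fin n // q ≠ (0, i₀)}) :=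
    ⟨Sum.inr ⟨(⟨1, by omega⟩, i₀), fun h => by simpa using congrArg (fun q => (q.1 : ℕ)) h⟩⟩
  have hcard : Fintype.card (OffColumn d i₀ ⊕ {q : Fin (d + 1) × Fin n // q ≠ (0, i₀)}) =
      (d + 1) * n ^ 2 - 1 := by
    obtain ⟨m, rfl⟩ := Nat.exists_eq_succ_of_ne_zero hn
    simp only [OffColumn, Fintype.card_sum, Fintype.card_prod, Fintype.card_fin, ne_eq,
      Fintype.card_subtype_compl, Fintype.card_subtype_eq]
    have h1 : 1 ≤ (d + 1) * (m + 1) := Nat.mul_pos (by omega) (by omega)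
    rw [← Nat.add_sub_assoc h1]
    congr 1
    simp only [Nat.succ_eq_add_one, Nat.add_sub_cancel]
    ring
  rw [← hcard, ← lintegral_norm_gaussPi, ← measurePreserving_gaussPi_sumElim.map_eq,
    lintegral_map (by fun_prop) measurePreserving_gaussPi_sumElim.measurable,
    lintegral_prod _ (by
      simp only [Fintype.sum_sum_type, Sum.elim_inl, Sum.elim_inr]
      fun_prop)]
  simp only [Fintype.sum_sum_type, Sum.elim_inl, Sum.elim_inr]

lemma lintegral_muTotal (hn : n ≠ 0) (hd : d ≠ 0) :
    ENNReal.ofReal √(2 / π) * ∫⁻ A, muTotal n d A ∂gaussTuple n d =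
      ENNReal.ofReal (chiMean n) *
        ENNReal.ofReal (π * (√(2 * π))⁻¹ * chiMean ((d + 1) * n ^ 2 - 1)) := by
  have hgen := ae_isGeneric hn hd
  have : NeZero n := ⟨hn⟩
  have hfst : ∀ᵐ p ∂(gaussTuple n d).prod (gaussPi (Fin n)), IsGeneric p.1 :=
    Measure.quasiMeasurePreserving_fst.ae hgen
  have h1 : ∀ᵐ A ∂gaussTuple n d, ENNReal.ofReal √(2 / π) * muTotal n d A =
      ∫⁻ u, condSum A u ∂gaussPi (Fin n) :=
    hgen.mono fun A hA => hA.lintegral_tsum_condTerm.symm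
  rw [← lintegral_const_mul' _ _ ENNReal.ofReal_ne_top, lintegral_congr_ae h1,
    lintegral_lintegral_swap (aemeasurable_condSum continuous_fst continuous_snd hfst)]
  rw [lintegral_congr fun u => lintegral_condSum hn hd 0 u, lintegral_mul_const' _ _ (by
    rw [lintegral_condSum_single hd]
    exact ENNReal.ofReal_ne_top), lintegral_condSum_single hd, lintegral_norm_gaussPi,
    Fintype.card_fin]

end Column

/-- **Gaussian homogeneous polynomial eigenvalue problems are well conditioned on average**:
`E μ(A) = π · Γ((d+1)n²/2)/Γ(((d+1)n²−1)/2) · Γ((n+1)/2)/Γ(n/2)`. -/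
theorem expected_condition_number_gaussian (n d : ℕ) (hn : 1 ≤ n) (hd : 1 ≤ d) :
    ∫⁻ A, muTotal n d A ∂(gaussTuple n d) =
      ENNReal.ofReal
        (π * (Real.Gamma ((((d : ℝ) + 1) * (n : ℝ) ^ 2) / 2) /
              Real.Gamma ((((d : ℝ) + 1) * (n : ℝ) ^ 2 - 1) / 2)) *
          (Real.Gamma (((n : ℝ) + 1) / 2) / Real.Gamma ((n : ℝ) / 2))) := by
  have hsqrt : √(π / 2) * √(2 / π) = 1 := by
    rw [← Real.sqrt_mul (by positivity), div_mul_div_comm, mul_comm, div_self (by positivity),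
      Real.sqrt_one]
  have hcast : (((d + 1) * n ^ 2 - 1 : ℕ) : ℝ) = ((d : ℝ) + 1) * (n : ℝ) ^ 2 - 1 := by
    rw [Nat.cast_sub (Nat.mul_pos d.succ_pos (pow_pos hn 2))]
    push_cast
    ring
  have hconst : √(π / 2) * √2 * (√(2 * π))⁻¹ * √2 = 1 := by
    rw [← Real.sqrt_mul (by positivity), div_mul_cancel₀ _ two_ne_zero, mul_comm 2 π,
      Real.sqrt_mul Real.pi_pos.le]
    field_simp
  have hchi : 0 ≤ chiMean n := by
    unfold chiMean
    positivity
  calc ∫⁻ A, muTotal n d A ∂(gaussTuple n d)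
      = ENNReal.ofReal √(π / 2) *
          (ENNReal.ofReal √(2 / π) * ∫⁻ A, muTotal n d A ∂(gaussTuple n d)) := by
        rw [← mul_assoc, ← ENNReal.ofReal_mul (Real.sqrt_nonneg _), hsqrt, ENNReal.ofReal_one,
          one_mul]
    _ = _ := by
        rw [lintegral_muTotal (Nat.one_le_iff_ne_zero.1 hn) (Nat.one_le_iff_ne_zero.1 hd),
          ← ENNReal.ofReal_mul hchi, ← ENNReal.ofReal_mul (Real.sqrt_nonneg _)]
        congr 1
        simp only [chiMean, hcast, sub_add_cancel]
        linear_combination (π * (Gamma (((d:ℝ)+1)*(n:ℝ)^2/2) /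
          Gamma ((((d:ℝ)+1)*(n:ℝ)^2 - 1)/2)) * (Gamma (((n:ℝ)+1)/2) / Gamma ((n:ℝ)/2))) * hconst

end PEVP
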